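/- arXiv:2509.13796 — 6 statements merged into one kernel-verified Lean document; each statement's English description precedes it below -/
import Mathlib

section
/- Let p be a prime and n ≥ 2 an integer. Let E be a totally real Galois extension of ℚ with Gal(E/ℚ) ≅ (ℤ/pℤ)^{⊕n}, and let K_1, …, K_t, with t = (p^n − 1)/(p − 1), be the distinct subfields of E of degree p over ℚ. Then for every integer k ≥ 1 one has w_{2k}(ℚ)^{(p^n − p)/(p − 1)} · w_{2k}(E) = ∏_{j=1}^{t} w_{2k}(K_j). -/
open scoped Classical
noncomputable section

open Module

/-- The set of positive integers `m` such that the exponent of `Gal(F(μ_m)/F)` divides `j`. -/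
def wSet (F : Type*) [Field F] (j : ℕ) : Set ℕ :=
  {m | 0 < m ∧ ∀ σ : AlgebraicClosure F ≃ₐ[F] AlgebraicClosure F,
      ∀ ζ : AlgebraicClosure F, ζ ^ m = 1 → (σ ^ j) ζ = ζ}

/-- `w_j(F)`, the largest positive integer `m` such that `Gal(F(μ_m)/F)` has exponent
dividing `j`. -/
def w (F : Type*) [Field F] (j : ℕ) : ℕ := sSup (wSet F j)

/-- A field is totally real if every complex embedding takes values in `ℝ`. -/
def IsTotallyReal (F : Type*) [Field F] : Prop :=
  ∀ φ : F →+* ℂ, ∀ x : F, (φ x).im = 0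

theorem units_aux (l a : ℕ) (hl : l.Prime) :
    ∃ g : (ZMod (l ^ a))ˣ, ∀ u : (ZMod (l ^ a))ˣ, ∃ i : ℤ, u = g ^ i ∨ u = -1 * g ^ i := by
  by_cases h2 : IsCyclic (ZMod (l ^ a))ˣ
  · obtain ⟨g, hg⟩ := h2.exists_generator
    refine ⟨g, fun u => ?_⟩
    obtain ⟨i, hi⟩ := Subgroup.mem_zpowers_iff.1 (hg u)
    exact ⟨i, Or.inl hi.symm⟩
  · have hl2 : l = 2 := by
      by_contra h
      exact h2 (ZMod.isCyclic_units_of_prime_pow l hl h a)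
    subst hl2
    rw [ZMod.isCyclic_units_two_pow_iff] at h2
    obtain ⟨n, rfl⟩ : ∃ n, a = n + 2 := ⟨a - 2, by omega⟩
    have h5 : IsUnit (5 : ZMod (2 ^ (n + 2))) := by
      have := (ZMod.isUnit_iff_coprime 5 (2 ^ (n + 2))).2
        (Nat.Coprime.pow_right _ (by norm_num))
      exact_mod_cast this
    have ho : orderOf h5.unit = 2 ^ n := by
      rw [← orderOf_injective _ Units.coeHom_injective h5.unit, Units.coeHom_apply,
        IsUnit.unit_spec]
      exact ZMod.orderOf_five n
    set H := Subgroup.zpowers h5.unit with hH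
    have hcard : Nat.card H = 2 ^ n := by rw [hH, Nat.card_zpowers, ho]
    have htot : Nat.card (ZMod (2 ^ (n + 2)))ˣ = 2 ^ n * 2 := by
      rw [Nat.card_eq_fintype_card, ZMod.card_units_eq_totient,
        Nat.totient_prime_pow_succ Nat.prime_two]
      ring
    have hidx : H.index = 2 := by
      have := H.card_mul_index
      rw [hcard, htot] at this
      exact Nat.eq_of_mul_eq_mul_left (by positivity) this
    have hd : 4 ∣ 2 ^ (n + 2) := ⟨2 ^ n, by ring⟩
    have hneg : (-1 : (ZMod (2 ^ (n + 2)))ˣ) ∉ H := by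
      intro hm
      obtain ⟨i, hi⟩ := Subgroup.mem_zpowers_iff.1 hm
      have h1 := congrArg (ZMod.unitsMap hd) hi
      have h51 : ZMod.unitsMap hd h5.unit = 1 := by
        ext
        rw [ZMod.unitsMap_val, IsUnit.unit_spec]
        have : ((5 : ZMod (2 ^ (n + 2))).cast : ZMod 4) = 5 := by
          have := ZMod.cast_natCast hd 5 (R := ZMod 4)
          exact_mod_cast this
        rw [this]; rfl
      have hm1 : ZMod.unitsMap hd (-1) = -1 := by
        ext
        rw [ZMod.unitsMap_val]
        have := ZMod.cast_neg hd (1 : ZMod (2 ^ (n + 2))) (R := ZMod 4)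
        simpa [ZMod.cast_one hd] using this
      rw [map_zpow, h51, one_zpow, hm1] at h1
      exact absurd h1 (by decide)
    refine ⟨h5.unit, fun u => ?_⟩
    by_cases hu : u ∈ H
    · obtain ⟨i, hi⟩ := Subgroup.mem_zpowers_iff.1 hu
      exact ⟨i, Or.inl hi.symm⟩
    · have := (Subgroup.mul_mem_iff_of_index_two hidx (a := -1) (b := u)).2
        (by simp [hneg, hu])
      obtain ⟨i, hi⟩ := Subgroup.mem_zpowers_iff.1 this
      exact ⟨i, Or.inr (by rw [hi]; simp)⟩

theorem mem_wSet_iff_of_isAlgClosure (F Ω : Type*) [Field F] [Field Ω] [Algebra F Ω]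
    [IsAlgClosure F Ω] (j m : ℕ) :
    m ∈ wSet F j ↔ 0 < m ∧ ∀ σ : Ω ≃ₐ[F] Ω, ∀ ζ : Ω, ζ ^ m = 1 → (σ ^ j) ζ = ζ := by
  let e : AlgebraicClosure F ≃ₐ[F] Ω := IsAlgClosure.equiv F _ _
  unfold wSet
  constructor
  · rintro ⟨h0, h⟩
    refine ⟨h0, fun σ ζ hζ => ?_⟩
    have := h (AlgEquiv.autCongr e.symm σ) (e.symm ζ) (by rw [← map_pow, hζ, map_one])
    rw [← map_pow] at this
    simpa [AlgEquiv.autCongr_apply] using this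
  · rintro ⟨h0, h⟩
    refine ⟨h0, fun σ ζ hζ => ?_⟩
    have := h (AlgEquiv.autCongr e σ) (e ζ) (by rw [← map_pow, hζ, map_one])
    rw [← map_pow] at this
    simpa [AlgEquiv.autCongr_apply] using this

/-- The analogue of `wSet` for a subgroup of automorphisms. -/
def WS {Ω : Type*} [Field Ω] [Algebra ℚ Ω] (j : ℕ) (D : Subgroup (Ω ≃ₐ[ℚ] Ω)) : Set ℕ :=
  {m | 0 < m ∧ ∀ σ ∈ D, ∀ ζ : Ω, ζ ^ m = 1 → (σ ^ j) ζ = ζ}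

theorem wSet_eq_WS (F Ω : Type*) [Field F] [Field Ω] [Algebra F Ω] [Algebra ℚ F] [Algebra ℚ Ω]
    [IsScalarTower ℚ F Ω]
    [IsAlgClosure ℚ Ω] (j : ℕ) (D : Subgroup (Ω ≃ₐ[ℚ] Ω))
    (hD : ∀ σ : Ω ≃ₐ[ℚ] Ω, σ ∈ D ↔ ∀ x : F, σ (algebraMap F Ω x) = algebraMap F Ω x) :
    wSet F j = WS j D := by
  have : IsAlgClosure F Ω := ⟨IsAlgClosure.isAlgClosed ℚ,
    have : Algebra.IsAlgebraic ℚ Ω := IsAlgClosure.isAlgebraic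
    Algebra.IsAlgebraic.tower_top (K := ℚ) F⟩
  ext m
  rw [mem_wSet_iff_of_isAlgClosure F Ω]
  have key : ∀ (σ : Ω ≃ₐ[F] Ω) (τ : Ω ≃ₐ[ℚ] Ω), (∀ x, σ x = τ x) → ∀ j x,
      (σ ^ j) x = (τ ^ j) x := by
    intro σ τ h j
    induction j with
    | zero => intro x; rfl
    | succ n ih => intro x; rw [pow_succ, pow_succ, AlgEquiv.mul_apply, AlgEquiv.mul_apply, h, ih]
  constructor
  · rintro ⟨h0, h⟩
    refine ⟨h0, fun σ hσ ζ hζ => ?_⟩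
    rw [← key (AlgEquiv.ofRingEquiv (f := σ.toRingEquiv) ((hD σ).1 hσ)) σ (fun x => rfl)]
    exact h _ ζ hζ
  · rintro ⟨h0, h⟩
    refine ⟨h0, fun σ ζ hζ => ?_⟩
    rw [key σ (σ.restrictScalars ℚ) (fun x => rfl)]
    exact h _ ((hD _).2 fun x => σ.commutes x) ζ hζ

section WS
variable {Ω : Type*} [Field Ω] [Algebra ℚ Ω]

theorem WS_anti {j : ℕ} {D D' : Subgroup (Ω ≃ₐ[ℚ] Ω)} (h : D ≤ D') : WS j D' ⊆ WS j D :=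
  fun _ hm => ⟨hm.1, fun σ hσ => hm.2 σ (h hσ)⟩

theorem WS_dvd {j : ℕ} {D : Subgroup (Ω ≃ₐ[ℚ] Ω)} {m m' : ℕ} (hm : m ∈ WS j D) (h : m' ∣ m) :
    m' ∈ WS j D := by
  obtain ⟨c, rfl⟩ := h
  refine ⟨Nat.pos_of_mul_pos_right hm.1, fun σ hσ ζ hζ => hm.2 σ hσ ζ ?_⟩
  rw [pow_mul, hζ, one_pow]

theorem WS_lcm {j : ℕ} {D : Subgroup (Ω ≃ₐ[ℚ] Ω)} {a b : ℕ} (ha : a ∈ WS j D)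
    (hb : b ∈ WS j D) : Nat.lcm a b ∈ WS j D := by
  refine ⟨Nat.lcm_pos ha.1 hb.1, fun σ hσ ζ hζ => ?_⟩
  have hL : Nat.lcm a b ≠ 0 := (Nat.lcm_pos ha.1 hb.1).ne'
  have hζ0 : ζ ≠ 0 := by rintro rfl; simp [hL] at hζ
  obtain ⟨c, hc⟩ := Nat.dvd_lcm_left a b
  obtain ⟨d, hd⟩ := Nat.dvd_lcm_right a b
  have hcd : Nat.Coprime c d := by
    have hg := Nat.gcd_mul_lcm a b
    have e1 : c * Nat.gcd a b = b := by
      have : a * (c * Nat.gcd a b) = a * b := by rw [← hg, hc]; ring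
      exact Nat.eq_of_mul_eq_mul_left ha.1 this
    have e2 : d * Nat.gcd a b = a := by
      have : b * (d * Nat.gcd a b) = b * a := by rw [mul_comm b a, ← hg, hd]; ring
      exact Nat.eq_of_mul_eq_mul_left hb.1 this
    have hgp : 0 < Nat.gcd a b := Nat.gcd_pos_of_pos_left _ ha.1
    have : Nat.gcd c d * Nat.gcd a b = 1 * Nat.gcd a b := by
      rw [← Nat.gcd_mul_right, e1, e2, Nat.gcd_comm, one_mul]
    exact Nat.eq_of_mul_eq_mul_right hgp this
  have h1 : (σ ^ j) (ζ ^ c) = ζ ^ c := ha.2 σ hσ _ (by rw [← pow_mul, mul_comm, ← hc, hζ])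
  have h2 : (σ ^ j) (ζ ^ d) = ζ ^ d := hb.2 σ hσ _ (by rw [← pow_mul, mul_comm, ← hd, hζ])
  have hbz := Nat.gcd_eq_gcd_ab c d
  rw [Nat.coprime_iff_gcd_eq_one.1 hcd] at hbz
  have hz : ζ = (ζ ^ c) ^ (Nat.gcdA c d) * (ζ ^ d) ^ (Nat.gcdB c d) := by
    rw [← zpow_natCast, ← zpow_natCast, ← zpow_mul, ← zpow_mul, ← zpow_add₀ hζ0, ← hbz]
    simp
  rw [hz, map_mul, map_zpow₀, map_zpow₀, h1, h2]

theorem mem_WS_iff_dvd {j : ℕ} {D : Subgroup (Ω ≃ₐ[ℚ] Ω)} (hbd : BddAbove (WS j D)) (m : ℕ) :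
    m ∈ WS j D ↔ m ∣ sSup (WS j D) := by
  have hne : (WS j D).Nonempty := ⟨1, one_pos, fun σ _ ζ hζ => by
    rw [pow_one] at hζ; rw [hζ, map_one]⟩
  have hs := Nat.sSup_mem hne hbd
  refine ⟨fun hm => ?_, fun h => WS_dvd hs h⟩
  have h1 := le_csSup hbd (WS_lcm hm hs)
  have h2 : Nat.lcm m (sSup (WS j D)) = sSup (WS j D) :=
    le_antisymm h1 (Nat.le_of_dvd (Nat.lcm_pos hm.1 hs.1) (Nat.dvd_lcm_right _ _))
  rw [← h2]; exact Nat.dvd_lcm_left _ _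

theorem WS_ssup_pos {j : ℕ} {D : Subgroup (Ω ≃ₐ[ℚ] Ω)} (hbd : BddAbove (WS j D)) :
    0 < sSup (WS j D) :=
  ((mem_WS_iff_dvd hbd _).2 dvd_rfl).1

theorem aut_exists [IsAlgClosure ℚ Ω] {m : ℕ} [NeZero m] {ζ : Ω} (hζ : IsPrimitiveRoot ζ m) :
    Function.Surjective (hζ.autToPow ℚ) := by
  intro u
  have hn : Normal ℚ Ω := IsAlgClosure.normal ℚ Ω
  have hu := ZMod.val_coe_unit_coprime u
  have hζ' := hζ.pow_of_coprime _ hu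
  have h0 : CharZero Ω := algebraRat.charZero Ω
  have hconj : IsConjRoot ℚ (ζ ^ (u : ZMod m).val) ζ := by
    have key : ∀ y : Ω, IsPrimitiveRoot y m → minpoly ℚ y = Polynomial.cyclotomic m ℚ := by
      intro y hy
      convert (Polynomial.cyclotomic_eq_minpoly_rat hy (NeZero.pos m)).symm
      exact Subsingleton.elim _ _
    unfold IsConjRoot
    rw [key _ hζ, key _ hζ']
  obtain ⟨σ, hσ⟩ := isConjRoot_iff_exists_algEquiv.1 hconj
  refine ⟨σ, ?_⟩
  have hs := hζ.autToPow_spec ℚ σ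
  rw [hσ] at hs
  have := hζ.pow_inj (ZMod.val_lt _) (ZMod.val_lt _) hs
  exact Units.ext (ZMod.val_injective _ this)

theorem aut_eq_of {m : ℕ} [NeZero m] {ζ : Ω} (hζ : IsPrimitiveRoot ζ m) {σ τ : Ω ≃ₐ[ℚ] Ω}
    (h : hζ.autToPow ℚ σ = hζ.autToPow ℚ τ) {x : Ω} (hx : x ^ m = 1) : σ x = τ x := by
  obtain ⟨i, -, rfl⟩ := hζ.eq_pow_of_pow_eq_one hx
  rw [map_pow, map_pow, ← hζ.autToPow_spec ℚ σ, ← hζ.autToPow_spec ℚ τ, h]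

theorem autToPow_eq {m : ℕ} [NeZero m] {ζ : Ω} (hζ : IsPrimitiveRoot ζ m) {σ : Ω ≃ₐ[ℚ] Ω}
    (u : (ZMod m)ˣ) (h : σ ζ = ζ ^ (u : ZMod m).val) : hζ.autToPow ℚ σ = u := by
  rw [← hζ.autToPow_spec ℚ σ] at h
  exact Units.ext (ZMod.val_injective _ (hζ.pow_inj (ZMod.val_lt _) (ZMod.val_lt _) h))

/-- Every unit is killed by `N` when all automorphisms are. -/
theorem units_pow [IsAlgClosure ℚ Ω] {m N : ℕ} (hm : m ∈ WS N (⊤ : Subgroup (Ω ≃ₐ[ℚ] Ω)))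
    (u : (ZMod m)ˣ) : u ^ N = 1 := by
  have : NeZero m := ⟨hm.1.ne'⟩
  have h0 : CharZero Ω := algebraRat.charZero Ω
  have := IsAlgClosure.isAlgClosed ℚ (K := Ω)
  have hmz : NeZero (m : Ω) := ⟨by exact_mod_cast hm.1.ne'⟩
  obtain ⟨ζ, hζ⟩ := HasEnoughRootsOfUnity.exists_primitiveRoot Ω m
  obtain ⟨σ, rfl⟩ := aut_exists hζ u
  rw [← map_pow]
  have := hm.2 σ trivial ζ hζ.pow_eq_one
  have h1 : hζ.autToPow ℚ (σ ^ N) = hζ.autToPow ℚ 1 := by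
    refine autToPow_eq hζ _ ?_
    rw [hζ.autToPow_spec ℚ 1, this]; rfl
  rw [h1, map_one]

theorem WS_top_bdd [IsAlgClosure ℚ Ω] {N : ℕ} (hN : 0 < N) :
    BddAbove (WS N (⊤ : Subgroup (Ω ≃ₐ[ℚ] Ω))) := by
  have key : ∀ c m : ℕ, 2 ≤ c → m ∈ WS N (⊤ : Subgroup (Ω ≃ₐ[ℚ] Ω)) → Nat.Coprime c m →
      m ≤ c ^ N := by
    intro c m hc hm hcm
    have h := units_pow hm (ZMod.unitOfCoprime c hcm)
    have h2 := congrArg (Units.val) h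
    rw [Units.val_pow_eq_pow_val, ZMod.coe_unitOfCoprime, Units.val_one] at h2
    have h3 : ((c ^ N : ℕ) : ZMod m) = ((1 : ℕ) : ZMod m) := by push_cast; exact h2
    rw [ZMod.natCast_eq_natCast_iff] at h3
    have hlt : 1 < c ^ N := Nat.one_lt_pow hN.ne' (by omega)
    have h4 := (Nat.modEq_iff_dvd' hlt.le).1 h3.symm
    have := Nat.le_of_dvd (by omega) h4
    omega
  refine ⟨3 ^ N * 2 ^ N, fun m hm => ?_⟩
  obtain ⟨s, r, hr, hmr⟩ := Nat.exists_eq_two_pow_mul_odd hm.1.ne'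
  rw [hmr] at hm ⊢
  refine Nat.mul_le_mul (key 3 _ (by norm_num) (WS_dvd hm (dvd_mul_right _ _)) ?_)
    (key 2 _ le_rfl (WS_dvd hm (dvd_mul_left _ _)) ?_)
  · exact Nat.Coprime.pow_right _ (by norm_num)
  · exact Nat.coprime_two_left.2 hr

theorem WS_bdd [IsAlgClosure ℚ Ω] {j q : ℕ} (hj : 0 < j) (hq : 0 < q)
    {D : Subgroup (Ω ≃ₐ[ℚ] Ω)} (hD : ∀ σ, σ ^ q ∈ D) : BddAbove (WS j D) := by
  refine (WS_top_bdd (Ω := Ω) (N := q * j) (by positivity)).mono ?_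
  intro m hm
  refine ⟨hm.1, fun σ _ ζ hζ => ?_⟩
  rw [pow_mul]
  exact hm.2 _ (hD σ) ζ hζ

theorem WS_prime_pow {m m' j : ℕ} [NeZero m] {ζ : Ω} (hζ : IsPrimitiveRoot ζ m) (hm : m' ∣ m)
    {D D' : Subgroup (Ω ≃ₐ[ℚ] Ω)} (hD : D' ≤ D ⊔ (hζ.autToPow ℚ).ker) (h : m' ∈ WS j D) :
    m' ∈ WS j D' := by
  refine ⟨h.1, fun σ hσ x hx => ?_⟩
  obtain ⟨d, hd, t, ht, rfl⟩ := Subgroup.mem_sup_of_normal_right.1 (hD hσ)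
  obtain ⟨c, rfl⟩ := hm
  rw [aut_eq_of hζ (σ := (d * t) ^ j) (τ := d ^ j)]
  · rw [h.2 d hd x hx]
  · rw [map_pow, map_mul, MonoidHom.mem_ker.1 ht, mul_one, map_pow]
  · rw [pow_mul, hx, one_pow]

end WS

theorem exists_conj (E Ω : Type*) [Field E] [NumberField E] [Field Ω] [Algebra ℚ Ω] [Algebra E Ω]
    [IsScalarTower ℚ E Ω] [IsAlgClosure ℚ Ω] (hreal : IsTotallyReal E) :
    ∃ c : Ω ≃ₐ[ℚ] Ω, (∀ x : E, c (algebraMap E Ω x) = algebraMap E Ω x) ∧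
      ∀ m : ℕ, 0 < m → ∀ ζ : Ω, ζ ^ m = 1 → c ζ = ζ⁻¹ := by
  have hn : Normal ℚ Ω := IsAlgClosure.normal ℚ Ω
  have ha : Algebra.IsAlgebraic ℚ Ω := IsAlgClosure.isAlgebraic
  let φ : Ω →ₐ[ℚ] ℂ := IsAlgClosed.lift
  let _ : Algebra Ω ℂ := φ.toRingHom.toAlgebra
  have : IsScalarTower ℚ Ω ℂ := IsScalarTower.of_algebraMap_eq fun x => (φ.commutes x).symm
  let cc : ℂ ≃ₐ[ℚ] ℂ := Complex.conjAe.restrictScalars ℚ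
  have hc : ∀ x, φ (cc.restrictNormal Ω x) = (starRingEnd ℂ) (φ x) :=
    fun x => cc.restrictNormal_commutes Ω x
  refine ⟨cc.restrictNormal Ω, fun x => ?_, fun m hm ζ hζ => ?_⟩
  · apply φ.injective
    change φ _ = φ _
    rw [hc]
    exact Complex.conj_eq_iff_im.2 (hreal (φ.toRingHom.comp (algebraMap E Ω)) x)
  · apply φ.injective
    change φ _ = φ _
    rw [hc, map_inv₀]
    have h1 : (φ ζ) ^ m = 1 := by rw [← map_pow, hζ, map_one]
    exact (Complex.inv_eq_conj (Complex.norm_eq_one_of_pow_eq_one h1 hm.ne')).symm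

theorem eq_of_index_eq {H : Type*} [Group H] [Finite H] {A B : Subgroup H} (h : A ≤ B)
    (hi : A.index = B.index) : A = B := by
  have h1 := A.card_mul_index
  rw [← B.card_mul_index, hi] at h1
  have h2 : 0 < B.index := Nat.pos_of_ne_zero Subgroup.FiniteIndex.index_ne_zero
  exact Subgroup.eq_of_le_of_card_ge h (Nat.eq_of_mul_eq_mul_right h2 h1).ge

section Main
variable (E Ω : Type*) [Field E] [NumberField E] [Field Ω] [Algebra ℚ Ω] [Algebra E Ω]
    [IsScalarTower ℚ E Ω] [IsAlgClosure ℚ Ω] [IsGalois ℚ E]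

theorem w_rat (j : ℕ) : w ℚ j = sSup (WS j (⊤ : Subgroup (Ω ≃ₐ[ℚ] Ω))) := by
  unfold w
  rw [wSet_eq_WS ℚ Ω j ⊤ (fun σ => by simp)]

theorem res_comm (σ : Ω ≃ₐ[ℚ] Ω) (x : E) :
    algebraMap E Ω (AlgEquiv.restrictNormalHom E σ x) = σ (algebraMap E Ω x) :=
  AlgEquiv.restrictNormal_commutes σ E x

theorem w_top (j : ℕ) : w E j = sSup (WS j
    ((⊥ : Subgroup (E ≃ₐ[ℚ] E)).comap (AlgEquiv.restrictNormalHom (K₁ := Ω) E))) := by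
  unfold w
  rw [wSet_eq_WS E Ω j _]
  intro σ
  rw [Subgroup.mem_comap, Subgroup.mem_bot]
  constructor
  · intro h x
    rw [← res_comm, h]; rfl
  · intro h
    ext x
    apply (algebraMap E Ω).injective
    rw [res_comm, h]; rfl

theorem w_mid (j : ℕ) (L : IntermediateField ℚ E) : w L j = sSup (WS j
    (L.fixingSubgroup.comap (AlgEquiv.restrictNormalHom (K₁ := Ω) E))) := by
  have : IsScalarTower ℚ L Ω := inferInstance
  unfold w
  rw [wSet_eq_WS L Ω j _]
  intro σ
  rw [Subgroup.mem_comap, IntermediateField.mem_fixingSubgroup_iff]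
  constructor
  · intro h x
    change σ (algebraMap E Ω x) = algebraMap E Ω x
    rw [← res_comm, h x x.2]
  · intro h x hx
    apply (algebraMap E Ω).injective
    rw [res_comm]
    exact h ⟨x, hx⟩

theorem comap_le_aux {G H : Type*} [Group G] [Group H] (f : G →* H) (N : Subgroup G) [N.Normal]
    (hf : Function.Surjective f) (A B : Subgroup H) (h : A ≤ B ⊔ N.map f) :
    A.comap f ≤ B.comap f ⊔ N := by
  have : (N.map f).Normal := Subgroup.Normal.map inferInstance f hf
  intro x hx
  obtain ⟨b, hb, y, ⟨n, hn, rfl⟩, hxy⟩ := Subgroup.mem_sup_of_normal_right.1 (h hx)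
  refine Subgroup.mem_sup_of_normal_right.2 ⟨x * n⁻¹, ?_, n, hn, by simp⟩
  rw [Subgroup.mem_comap, map_mul, map_inv, ← hxy]
  simpa using hb

/-- The image in `Gal(E/ℚ)` of the kernel of the cyclotomic character has index `1` or `p`. -/
theorem index_aux (hreal : IsTotallyReal E) (p l a : ℕ) (hl : l.Prime)
    (hp : p.Prime) (hexp : ∀ x : E ≃ₐ[ℚ] E, x ^ p = 1) [NeZero (l ^ a)] {ζ : Ω}
    (hζ : IsPrimitiveRoot ζ (l ^ a)) :
    ((hζ.autToPow ℚ).ker.map (AlgEquiv.restrictNormalHom (K₁ := Ω) E)).index = 1 ∨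
    ((hζ.autToPow ℚ).ker.map (AlgEquiv.restrictNormalHom (K₁ := Ω) E)).index = p := by
  have hn : Normal ℚ Ω := IsAlgClosure.normal ℚ Ω
  set f : (Ω ≃ₐ[ℚ] Ω) →* (E ≃ₐ[ℚ] E) := AlgEquiv.restrictNormalHom (K₁ := Ω) E with hf
  have hs : Function.Surjective f := AlgEquiv.restrictNormalHom_surjective Ω
  have hN : ((hζ.autToPow ℚ).ker.map f).Normal := Subgroup.Normal.map inferInstance f hs
  set D := (hζ.autToPow ℚ).ker.map f with hD
  obtain ⟨g, hg⟩ := units_aux l a hl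
  obtain ⟨γ, hγ⟩ := aut_exists hζ g
  obtain ⟨c, hcE, hcζ⟩ := exists_conj E Ω hreal
  have hc1 : f c = 1 := by
    ext x
    apply (algebraMap E Ω).injective
    rw [hf, res_comm, hcE]; rfl
  have hcm : hζ.autToPow ℚ c = -1 := by
    have h1 := hcζ _ (NeZero.pos (l ^ a)) ζ hζ.pow_eq_one
    have h2 : hζ.autToPow ℚ c * -1 = 1 := by
      have h3 := hζ.autToPow_spec ℚ c
      rw [h1] at h3
      have h4 : ζ ^ ((hζ.autToPow ℚ c : ZMod (l ^ a)).val + 1) = 1 := by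
        rw [pow_succ, h3, inv_mul_cancel₀ (hζ.ne_zero (NeZero.ne _))]
      rw [hζ.pow_eq_one_iff_dvd] at h4
      have h5 := (ZMod.natCast_eq_zero_iff _ _).2 h4
      push_cast at h5
      rw [ZMod.natCast_zmod_val] at h5
      ext
      push_cast
      linear_combination -h5
    rw [mul_neg_one, neg_eq_iff_eq_neg] at h2
    exact h2
  have hgen : ∀ x : (E ≃ₐ[ℚ] E) ⧸ D, x ∈ Subgroup.zpowers (QuotientGroup.mk' D (f γ)) := by
    intro x
    obtain ⟨y, rfl⟩ := QuotientGroup.mk'_surjective D x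
    obtain ⟨σ, rfl⟩ := hs y
    obtain ⟨i, hi⟩ := hg (hζ.autToPow ℚ σ)
    obtain ⟨τ, hτ1, hτ2⟩ : ∃ τ, hζ.autToPow ℚ σ = hζ.autToPow ℚ τ ∧ f τ = f γ ^ i := by
      rcases hi with hi | hi
      · exact ⟨γ ^ i, by rw [hi, map_zpow, hγ], map_zpow _ _ _⟩
      · exact ⟨c * γ ^ i, by rw [hi, map_mul, map_zpow, hγ, hcm],
          by rw [map_mul, map_zpow, hc1, one_mul]⟩
    refine Subgroup.mem_zpowers_iff.2 ⟨i, ?_⟩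
    rw [← map_zpow, ← hτ2]
    refine QuotientGroup.eq.2 ⟨τ⁻¹ * σ, ?_, by simp⟩
    change _ ∈ (hζ.autToPow ℚ).ker
    rw [MonoidHom.mem_ker, map_mul, hτ1, ← map_mul, inv_mul_cancel, map_one]
  have hcard := orderOf_eq_card_of_forall_mem_zpowers hgen
  have hdvd : orderOf (QuotientGroup.mk' D (f γ)) ∣ p :=
    orderOf_dvd_of_pow_eq_one (by rw [← map_pow, hexp, map_one])
  rw [hcard] at hdvd
  exact (Nat.dvd_prime hp).1 hdvd

end Main

theorem main_aux (E Ω : Type*) [Field E] [NumberField E] [Field Ω] [Algebra ℚ Ω] [Algebra E Ω]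
    [IsScalarTower ℚ E Ω] [IsAlgClosure ℚ Ω] [IsGalois ℚ E] (p n : ℕ) (hp : p.Prime) (hn : 2 ≤ n) (hreal : IsTotallyReal E)
    (giso : (E ≃ₐ[ℚ] E) ≃* Multiplicative (Fin n → ZMod p))
    (K : Fin ((p ^ n - 1) / (p - 1)) → IntermediateField ℚ E)
    (hinj : Function.Injective K)
    (hdeg : ∀ i, finrank ℚ ↥(K i) = p)
    (hall : ∀ L : IntermediateField ℚ E, finrank ℚ ↥L = p → ∃ i, L = K i)
    (k : ℕ) (hk : 1 ≤ k) :
    w ℚ (2 * k) ^ ((p ^ n - p) / (p - 1)) * w E (2 * k) =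
      ∏ i, w ↥(K i) (2 * k) := by
  have hnorm : Normal ℚ Ω := IsAlgClosure.normal ℚ Ω
  have hch : CharZero Ω := algebraRat.charZero Ω
  have hac := IsAlgClosure.isAlgClosed ℚ (K := Ω)
  have hexp : ∀ x : E ≃ₐ[ℚ] E, x ^ p = 1 := by
    intro x
    apply giso.injective
    rw [map_pow, map_one]
    apply Multiplicative.toAdd.injective
    rw [toAdd_pow]
    ext i
    simp
  have ht : (p ^ n - 1) / (p - 1) = (p ^ n - p) / (p - 1) + 1 := by
    have h2 := hp.two_le
    have h3 : p ≤ p ^ n := Nat.le_self_pow (by omega) p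
    have : p ^ n - 1 = (p ^ n - p) + (p - 1) := by omega
    rw [this, Nat.add_div_right _ (by omega)]
  let f : (Ω ≃ₐ[ℚ] Ω) →* (E ≃ₐ[ℚ] E) := AlgEquiv.restrictNormalHom (K₁ := Ω) E
  have hs : Function.Surjective f := AlgEquiv.restrictNormalHom_surjective Ω
  let S : Subgroup (E ≃ₐ[ℚ] E) → ℕ := fun Δ => sSup (WS (2 * k) (Δ.comap f))
  have hb : ∀ Δ : Subgroup (E ≃ₐ[ℚ] E), BddAbove (WS (2 * k) (Δ.comap f)) := by
    intro Δ
    refine WS_bdd (q := p) (by omega) hp.pos fun σ => ?_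
    rw [Subgroup.mem_comap, map_pow, hexp]
    exact one_mem _
  have hpos : ∀ Δ, S Δ ≠ 0 := fun Δ => (WS_ssup_pos (hb Δ)).ne'
  have hQ : w ℚ (2 * k) = S ⊤ := by
    rw [w_rat Ω]; simp only [S, Subgroup.comap_top]
  have hE : w E (2 * k) = S ⊥ := w_top E Ω _
  have hK : ∀ i, w (K i) (2 * k) = S (K i).fixingSubgroup := fun i => w_mid E Ω _ _
  rw [hQ, hE]
  simp_rw [hK]
  refine Nat.eq_of_factorization_eq (mul_ne_zero (pow_ne_zero _ (hpos _)) (hpos _))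
    (Finset.prod_ne_zero_iff.2 fun i _ => hpos _) fun l => ?_
  by_cases hl : l.Prime
  swap
  · rw [Nat.factorization_eq_zero_of_not_prime _ hl, Nat.factorization_eq_zero_of_not_prime _ hl]
  rw [Nat.factorization_mul (pow_ne_zero _ (hpos _)) (hpos _), Nat.factorization_pow,
    Nat.factorization_prod (fun i _ => hpos _)]
  simp only [Finsupp.add_apply, Finsupp.smul_apply, Finsupp.finsetSum_apply, smul_eq_mul]
  set v : Subgroup (E ≃ₐ[ℚ] E) → ℕ := fun Δ => (S Δ).factorization l with hv
  change _ * v ⊤ + v ⊥ = ∑ i, v (K i).fixingSubgroup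
  have hvle : ∀ Δ, v Δ ≤ v ⊥ := by
    intro Δ
    refine (Nat.factorization_le_iff_dvd (hpos _) (hpos _)).2 ?_ l
    refine (mem_WS_iff_dvd (hb ⊥) _).1 ?_
    exact WS_anti (Subgroup.comap_mono bot_le) ((mem_WS_iff_dvd (hb Δ) _).2 dvd_rfl)
  set a := v ⊥ with ha
  have hla : NeZero (l ^ a) := ⟨pow_ne_zero _ hl.ne_zero⟩
  have hlz : NeZero ((l ^ a : ℕ) : Ω) := ⟨by exact_mod_cast hla.ne⟩
  obtain ⟨ζ, hζ⟩ := HasEnoughRootsOfUnity.exists_primitiveRoot Ω (l ^ a)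
  set D := (hζ.autToPow ℚ).ker.map f with hD
  have hcmp : ∀ A B : Subgroup (E ≃ₐ[ℚ] E), A ≤ B ⊔ D → v B ≤ v A := by
    intro A B hAB
    refine (hl.pow_dvd_iff_le_factorization (hpos _)).1 ?_
    refine (mem_WS_iff_dvd (hb A) _).1 ?_
    refine WS_prime_pow hζ (pow_dvd_pow l (hvle B)) (comap_le_aux f _ hs A B hAB) ?_
    refine (mem_WS_iff_dvd (hb B) _).2 ?_
    exact (hl.pow_dvd_iff_le_factorization (hpos _)).2 le_rfl
  have hidxK : ∀ i, (K i).fixingSubgroup.index = p := fun i => by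
    rw [← IntermediateField.finrank_eq_fixingSubgroup_index, hdeg]
  obtain ⟨i0, h1, h2⟩ : ∃ i0, v (K i0).fixingSubgroup = v ⊥ ∧
      ∀ i, i ≠ i0 → v (K i).fixingSubgroup = v ⊤ := by
    rcases index_aux E Ω hreal p l a hl hp hexp hζ with h | h
    · have hDt : D = ⊤ := Subgroup.index_eq_one.1 h
      have hall : ∀ A B, v A = v B := fun A B =>
        le_antisymm (hcmp _ _ (by rw [hDt]; simp)) (hcmp _ _ (by rw [hDt]; simp))
      exact ⟨⟨0, by rw [ht]; exact Nat.succ_pos _⟩, hall _ _, fun i _ => hall _ _⟩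
    · change D.index = p at h
      obtain ⟨i0, hi0⟩ := hall (IntermediateField.fixedField D) (by
        rw [IntermediateField.finrank_eq_fixingSubgroup_index,
          IntermediateField.fixingSubgroup_fixedField, h])
      have hDi : (K i0).fixingSubgroup = D := by
        rw [← hi0, IntermediateField.fixingSubgroup_fixedField]
      refine ⟨i0, ?_, fun i hi => ?_⟩
      · refine le_antisymm (hvle _) (hcmp _ _ ?_)
        rw [hDi]; exact le_sup_right
      · refine le_antisymm (hcmp _ _ ?_) (hcmp _ _ ?_)
        · rw [top_le_iff]
          have hd : ((K i).fixingSubgroup ⊔ D).index ∣ p := by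
            rw [← h]; exact Subgroup.index_dvd_of_le le_sup_right
          rcases (Nat.dvd_prime hp).1 hd with h3 | h3
          · exact Subgroup.index_eq_one.1 h3
          · exfalso
            have e1 : (K i).fixingSubgroup = (K i).fixingSubgroup ⊔ D :=
              eq_of_index_eq le_sup_left (by rw [h3, hidxK])
            have e2 : D = (K i).fixingSubgroup ⊔ D :=
              eq_of_index_eq le_sup_right (by rw [h3, h])
            have e3 : (K i).fixingSubgroup = (K i0).fixingSubgroup := by
              rw [hDi, e1, ← e2]
            apply hi
            apply hinj
            rw [← IsGalois.fixedField_fixingSubgroup (K i), e3,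
              IsGalois.fixedField_fixingSubgroup]
        · simp
  rw [← Finset.add_sum_erase _ _ (Finset.mem_univ i0), h1,
    Finset.sum_congr rfl (fun i hi => h2 i (Finset.ne_of_mem_erase hi)), Finset.sum_const,
    Finset.card_erase_of_mem (Finset.mem_univ i0), Finset.card_univ, Fintype.card_fin, ht,
    smul_eq_mul, Nat.add_sub_cancel, add_comm]


theorem w_prod_of_p_elementary
    (p n : ℕ) (hp : p.Prime) (hn : 2 ≤ n)
    (E : Type*) [Field E] [NumberField E] (hreal : IsTotallyReal E)
    [IsGalois ℚ E]
    (giso : (E ≃ₐ[ℚ] E) ≃* Multiplicative (Fin n → ZMod p))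
    (K : Fin ((p ^ n - 1) / (p - 1)) → IntermediateField ℚ E)
    (hinj : Function.Injective K)
    (hdeg : ∀ i, finrank ℚ ↥(K i) = p)
    (hall : ∀ L : IntermediateField ℚ E, finrank ℚ ↥L = p → ∃ i, L = K i)
    (k : ℕ) (hk : 1 ≤ k) :
    w ℚ (2 * k) ^ ((p ^ n - p) / (p - 1)) * w E (2 * k) =
      ∏ i, w ↥(K i) (2 * k) := by
  have : IsAlgClosure ℚ (AlgebraicClosure E) := ⟨inferInstance,
    Algebra.IsAlgebraic.trans ℚ E (AlgebraicClosure E)⟩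
  exact main_aux E (AlgebraicClosure E) p n hp hn hreal giso K hinj hdeg hall k hk
end
end

section
/- Let p be a prime and n ≥ 2 an integer. Let E be a totally real Galois extension of ℚ with Gal(E/ℚ) ≅ (ℤ/pℤ)^{⊕n}, and let K_1, …, K_t, with t = (p^n − 1)/(p − 1), be the distinct subfields of E of degree p over ℚ. Then for every prime ℓ and every integer k ≥ 1 one has w_{2k}^{(ℓ)}(ℚ)^{(p^n − p)/(p − 1)} · w_{2k}^{(ℓ)}(E) = ∏_{j=1}^{t} w_{2k}^{(ℓ)}(K_j). -/
open scoped Classical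
noncomputable section

open Module

/-- `w_j^{(ℓ)}(F)`, the largest power `ℓ^a` such that `Gal(F(μ_{ℓ^a})/F)` has exponent
dividing `j`. -/
def wl (F : Type*) [Field F] (j : ℕ) (ℓ : ℕ) : ℕ :=
  ℓ ^ sSup {a : ℕ | ∀ σ : AlgebraicClosure F ≃ₐ[F] AlgebraicClosure F,
      ∀ ζ : AlgebraicClosure F, ζ ^ ℓ ^ a = 1 → (σ ^ j) ζ = ζ}

lemma wlaux_cyc (ℓ : ℕ) (hℓ : ℓ.Prime) (a : ℕ) :
    ∃ C : Subgroup (ZMod (ℓ ^ a))ˣ, IsCyclic C ∧ ∀ x : (ZMod (ℓ ^ a))ˣ, x ^ 2 ∈ C := by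
  by_cases h2 : ℓ = 2
  · subst h2
    by_cases ha : a ≤ 2
    · have := (ZMod.isCyclic_units_two_pow_iff a).2 ha
      exact ⟨⊤, inferInstance, fun x => Subgroup.mem_top _⟩
    · obtain ⟨m, rfl⟩ : ∃ m, a = m + 2 := ⟨a - 2, by omega⟩
      have hd : 4 ∣ 2 ^ (m + 2) := ⟨2 ^ m, by ring⟩
      have hcop : Nat.Coprime 5 (2 ^ (m + 2)) := Nat.Coprime.pow_right _ (by norm_num)
      let u : (ZMod (2 ^ (m + 2)))ˣ := ZMod.unitOfCoprime 5 hcop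
      have hu : orderOf u = 2 ^ m := by
        rw [← orderOf_units]
        have : (u : ZMod (2 ^ (m + 2))) = 5 := by simp [u]
        rw [this, ZMod.orderOf_five]
      let f := ZMod.unitsMap hd
      have hle : Subgroup.zpowers u ≤ f.ker := by
        rw [Subgroup.zpowers_le, MonoidHom.mem_ker]
        ext
        simp only [f, u, ZMod.unitsMap_def, Units.coe_map, ZMod.coe_unitOfCoprime]
        rw [MonoidHom.coe_coe, map_natCast]
        decide
      have hc : Nat.card f.ker = 2 ^ m := by
        have h1 := f.ker.card_mul_index
        rw [Subgroup.index_ker] at h1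
        have h3 : f.range = ⊤ := MonoidHom.range_eq_top.2 (ZMod.unitsMap_surjective hd)
        rw [h3, Subgroup.card_top, Nat.card_eq_fintype_card (α := (ZMod 4)ˣ),
          Nat.card_eq_fintype_card (α := (ZMod (2 ^ (m+2)))ˣ), ZMod.card_units_eq_totient,
          ZMod.card_units_eq_totient, Nat.totient_prime_pow Nat.prime_two (by omega)] at h1
        have h4 : Nat.totient 4 = 2 := by decide
        rw [h4] at h1
        have h5 : m + 2 - 1 = m + 1 := by omega
        have h6 : 2 ^ (m + 2 - 1) = 2 ^ m * 2 := by rw [h5, pow_succ]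
        generalize Nat.card f.ker = c at *
        omega
      have heq : Subgroup.zpowers u = f.ker := by
        apply Subgroup.eq_of_le_of_card_ge hle
        rw [hc, Nat.card_zpowers, hu]
      refine ⟨Subgroup.zpowers u, inferInstance, fun x => ?_⟩
      rw [heq, MonoidHom.mem_ker, map_pow]
      generalize f x = y
      revert y
      decide
  · have := ZMod.isCyclic_units_of_prime_pow ℓ hℓ h2 a
    exact ⟨⊤, inferInstance, fun x => Subgroup.mem_top _⟩

lemma wlaux_char (Ω : Type*) [Field Ω] [CharZero Ω] [IsAlgClosed Ω] [Algebra ℚ Ω]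
    (ℓ : ℕ) (hℓ : ℓ.Prime) (k a : ℕ) :
    ∃ ψ : (Ω ≃ₐ[ℚ] Ω) →* (ZMod (ℓ ^ a))ˣ,
      (∀ σ, (∀ ζ : Ω, ζ ^ ℓ ^ a = 1 → (σ ^ (2 * k)) ζ = ζ) ↔ ψ σ = 1) ∧ IsCyclic ψ.range := by
  have : NeZero (ℓ ^ a) := ⟨pow_ne_zero _ hℓ.ne_zero⟩
  have : NeZero ((ℓ ^ a : ℕ) : Ω) := ⟨by exact_mod_cast pow_ne_zero _ hℓ.ne_zero⟩
  obtain ⟨μ, hμ⟩ := HasEnoughRootsOfUnity.exists_primitiveRoot Ω (ℓ ^ a)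
  let χ := hμ.autToPow ℚ
  refine ⟨(powMonoidHom (2 * k)).comp χ, fun σ => ?_, ?_⟩
  · have h1 : ((powMonoidHom (2 * k)).comp χ) σ = χ (σ ^ (2 * k)) := by simp
    rw [h1]
    generalize σ ^ (2 * k) = τ
    have hs : μ ^ (χ τ : ZMod (ℓ ^ a)).val = τ μ := hμ.autToPow_spec ℚ τ
    constructor
    · intro h
      have h2 := h μ hμ.pow_eq_one
      rw [h2] at hs
      have h3 : μ ^ (χ τ : ZMod (ℓ ^ a)).val = μ ^ 1 := by rw [hs, pow_one]
      rw [(hμ.isOfFinOrder (NeZero.ne _)).pow_eq_pow_iff_modEq, ← hμ.eq_orderOf, ← ZMod.natCast_eq_natCast_iff] at h3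
      ext
      simpa using h3
    · intro h ζ hζ
      have h2 : τ μ = μ := by
        rw [h] at hs
        rw [← hs]
        have h3 : μ ^ ((1 : (ZMod (ℓ ^ a))ˣ) : ZMod (ℓ ^ a)).val = μ ^ 1 := by
          rw [(hμ.isOfFinOrder (NeZero.ne _)).pow_eq_pow_iff_modEq, ← hμ.eq_orderOf, ← ZMod.natCast_eq_natCast_iff]
          simp
        rw [h3, pow_one]
      obtain ⟨i, -, rfl⟩ := hμ.eq_pow_of_pow_eq_one hζ
      rw [map_pow, h2]
  · obtain ⟨C, hC, hx⟩ := wlaux_cyc ℓ hℓ a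
    have hle : ((powMonoidHom (2 * k)).comp χ).range ≤ C := by
      rintro _ ⟨σ, rfl⟩
      have : ((powMonoidHom (2 * k)).comp χ) σ = ((χ σ) ^ 2) ^ k := by simp [pow_mul]
      rw [this]
      exact C.pow_mem (hx _) _
    exact isCyclic_of_injective (Subgroup.inclusion hle) (Subgroup.inclusion_injective hle)

lemma wlaux_mem (F Ω : Type*) [Field F] [Field Ω] [CharZero F] [Algebra F Ω]
    [Algebra ℚ Ω] [IsAlgClosure F Ω] (j ℓ a : ℕ) :
    (∀ σ : AlgebraicClosure F ≃ₐ[F] AlgebraicClosure F,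
      ∀ ζ : AlgebraicClosure F, ζ ^ ℓ ^ a = 1 → (σ ^ j) ζ = ζ) ↔
    ∀ σ : Ω ≃ₐ[ℚ] Ω, (∀ x : F, σ (algebraMap F Ω x) = algebraMap F Ω x) →
      ∀ ζ : Ω, ζ ^ ℓ ^ a = 1 → (σ ^ j) ζ = ζ := by
  let e : AlgebraicClosure F ≃ₐ[F] Ω := IsAlgClosure.equiv F _ _
  constructor
  · intro h σ hσ ζ hζ
    let τ : Ω ≃ₐ[F] Ω := AlgEquiv.ofRingEquiv (f := σ.toRingEquiv) hσ
    let τ' := (AlgEquiv.autCongr e.symm) τ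
    have h1 := h τ' (e.symm ζ) (by rw [← map_pow, hζ, map_one])
    rw [← map_pow] at h1
    have h2 : (τ ^ j) ζ = ζ := by simpa [AlgEquiv.autCongr] using h1
    have h3 : ∀ m : ℕ, ∀ x, (τ ^ m) x = (σ ^ m) x := by
      intro m
      induction m with
      | zero => intro x; simp
      | succ m ih => intro x; rw [pow_succ, pow_succ, AlgEquiv.mul_apply, AlgEquiv.mul_apply, ih]; rfl
    rw [← h3, h2]
  · intro h σ ζ hζ
    let τ := (AlgEquiv.autCongr e) σ
    let τ' : Ω ≃ₐ[ℚ] Ω := AlgEquiv.ofRingEquiv (f := τ.toRingEquiv) (fun x => by simp)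
    have h1 := h τ' (fun x => τ.commutes x) (e ζ) (by rw [← map_pow, hζ, map_one])
    have h3 : ∀ m : ℕ, ∀ x, (τ ^ m) x = (τ' ^ m) x := by
      intro m
      induction m with
      | zero => intro x; simp
      | succ m ih => intro x; rw [pow_succ, pow_succ, AlgEquiv.mul_apply, AlgEquiv.mul_apply, ih]; rfl
    rw [← h3, ← map_pow] at h1
    have h4 : (AlgEquiv.autCongr e (σ ^ j)) (e ζ) = e ((σ ^ j) ζ) := by
      rw [AlgEquiv.autCongr_apply]; simp only [AlgEquiv.trans_apply, AlgEquiv.symm_apply_apply]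
    rw [h4] at h1
    exact e.injective h1

/-- an index computation -/
lemma wlaux_index {Γ V C : Type*} [Group Γ] [Group V] [Group C] [Finite V] (p : ℕ) (hp : p.Prime)
    (hV : ∀ v : V, v ^ p = 1) (hcomm : ∀ v w : V, v * w = w * v)
    (r : Γ →* V) (hr : Function.Surjective r) (ψ : Γ →* C) (hψ : IsCyclic ψ.range)
    (hker : ∀ σ, r σ = 1 → ψ σ = 1) (hne : ∃ σ, ψ σ ≠ 1) :
    ∃ B : Subgroup V, (∀ σ, ψ σ = 1 ↔ r σ ∈ B) ∧ B.index = p := by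
  let B := ψ.ker.map r
  have hB : ∀ σ, ψ σ = 1 ↔ r σ ∈ B := by
    intro σ
    constructor
    · intro h
      exact ⟨σ, h, rfl⟩
    · rintro ⟨τ, hτ, h⟩
      have h1 := hker (σ * τ⁻¹) (by rw [map_mul, map_inv, h, mul_inv_cancel])
      rw [map_mul, map_inv, MonoidHom.mem_ker.1 hτ] at h1
      simpa using h1
  have hn : B.Normal := ⟨fun x hx g => by rw [hcomm g x]; simpa using hx⟩
  refine ⟨B, hB, ?_⟩
  obtain ⟨⟨_, g, rfl⟩, hg⟩ := hψ
  have hgen : ∀ x : V ⧸ B, x ∈ Subgroup.zpowers (QuotientGroup.mk (s := B) (r g)) := by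
    intro x
    obtain ⟨v, rfl⟩ := QuotientGroup.mk_surjective x
    obtain ⟨σ, rfl⟩ := hr v
    obtain ⟨m, hm⟩ := hg ⟨ψ σ, σ, rfl⟩
    refine ⟨m, ?_⟩
    have hm' : ψ g ^ m = ψ σ := congrArg Subtype.val hm
    change (QuotientGroup.mk (r g) : V ⧸ B) ^ m = _
    rw [← QuotientGroup.mk_zpow, QuotientGroup.eq, ← map_zpow, ← map_inv, ← map_mul, ← hB]
    rw [map_mul, map_inv, map_zpow, hm', inv_mul_cancel]
  have hcard : B.index ∣ p := by
    rw [Subgroup.index, ← orderOf_eq_card_of_forall_mem_zpowers hgen]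
    apply orderOf_dvd_of_pow_eq_one
    rw [← QuotientGroup.mk_pow, hV]; rfl
  rcases (Nat.dvd_prime hp).1 hcard with h | h
  · exfalso
    obtain ⟨σ, hσ⟩ := hne
    rw [Subgroup.index_eq_one] at h
    exact hσ ((hB σ).2 (by rw [h]; trivial))
  · exact h

instance (priority := 2000) wlaux_tf (F Ω : Type*) [Field F] [Field Ω] [Algebra F Ω] :
    Module.IsTorsionFree F Ω := inferInstance

lemma wlaux_closure {E Ω : Type*} [Field E] [NumberField E] [Field Ω] [Algebra E Ω]
    [IsAlgClosure E Ω] (L : IntermediateField ℚ E) : IsAlgClosure L Ω :=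
  ⟨IsAlgClosure.isAlgClosed E, Algebra.IsAlgebraic.trans L E Ω⟩

theorem wl_prod_of_p_elementary
    (p n : ℕ) (hp : p.Prime) (hn : 2 ≤ n)
    (E : Type*) [Field E] [NumberField E] (hreal : IsTotallyReal E)
    [IsGalois ℚ E]
    (giso : (E ≃ₐ[ℚ] E) ≃* Multiplicative (Fin n → ZMod p))
    (K : Fin ((p ^ n - 1) / (p - 1)) → IntermediateField ℚ E)
    (hinj : Function.Injective K)
    (hdeg : ∀ i, finrank ℚ ↥(K i) = p)
    (hall : ∀ L : IntermediateField ℚ E, finrank ℚ ↥L = p → ∃ i, L = K i)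
    (ℓ : ℕ) (hℓ : ℓ.Prime) (k : ℕ) (hk : 1 ≤ k) :
    wl ℚ (2 * k) ℓ ^ ((p ^ n - p) / (p - 1)) * wl E (2 * k) ℓ =
      ∏ i, wl ↥(K i) (2 * k) ℓ := by
  let Ω := AlgebraicClosure E
  have hcomm : ∀ v w : E ≃ₐ[ℚ] E, v * w = w * v := fun v w => giso.injective (by
    rw [map_mul, map_mul, mul_comm])
  have hV : ∀ v : E ≃ₐ[ℚ] E, v ^ p = 1 := fun v => giso.injective (by
    rw [map_pow, map_one]
    apply Multiplicative.toAdd.injective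
    ext i
    simp)
  have hQ : IsAlgClosure ℚ Ω := ⟨inferInstance, Algebra.IsAlgebraic.trans ℚ E Ω⟩
  have hK : ∀ i, IsAlgClosure (K i) Ω := fun i => wlaux_closure (K i)
  let r : (Ω ≃ₐ[ℚ] Ω) →* (E ≃ₐ[ℚ] E) := AlgEquiv.restrictNormalHom E
  have hr : Function.Surjective r := AlgEquiv.restrictNormalHom_surjective Ω
  have hrc : ∀ σ : Ω ≃ₐ[ℚ] Ω, ∀ x : E, algebraMap E Ω (r σ x) = σ (algebraMap E Ω x) :=
    fun σ x => AlgEquiv.restrictNormal_commutes σ E x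
  let P : ℕ → (Ω ≃ₐ[ℚ] Ω) → Prop := fun a σ => ∀ ζ : Ω, ζ ^ ℓ ^ a = 1 → (σ ^ (2 * k)) ζ = ζ
  have hmono : ∀ a b, a ≤ b → ∀ σ, P b σ → P a σ := by
    intro a b hab σ h ζ hζ
    apply h
    obtain ⟨c, rfl⟩ := Nat.exists_eq_add_of_le hab
    rw [pow_add, pow_mul, hζ, one_pow]
  have wQ : wl ℚ (2 * k) ℓ = ℓ ^ sSup {a | ∀ σ, P a σ} := by
    unfold wl
    congr 2
    ext a
    simp only [Set.mem_setOf_eq]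
    rw [wlaux_mem ℚ Ω]
    simp [P]
  have wE : wl E (2 * k) ℓ = ℓ ^ sSup {a | ∀ σ, r σ = 1 → P a σ} := by
    unfold wl
    congr 2
    ext a
    simp only [Set.mem_setOf_eq]
    rw [wlaux_mem E Ω]
    refine forall_congr' fun σ => ?_
    have : (∀ x : E, σ (algebraMap E Ω x) = algebraMap E Ω x) ↔ r σ = 1 := by
      rw [AlgEquiv.ext_iff]
      refine forall_congr' fun x => ?_
      rw [← hrc, (algebraMap E Ω).injective.eq_iff]; rfl
    rw [this]
  have wK : ∀ i, wl (K i) (2 * k) ℓ =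
      ℓ ^ sSup {a | ∀ σ, r σ ∈ (K i).fixingSubgroup → P a σ} := by
    intro i
    unfold wl
    congr 2
    ext a
    simp only [Set.mem_setOf_eq]
    have := hK i
    rw [wlaux_mem (K i) Ω]
    refine forall_congr' fun σ => ?_
    have : (∀ x : K i, σ (algebraMap (K i) Ω x) = algebraMap (K i) Ω x) ↔
        r σ ∈ (K i).fixingSubgroup := by
      rw [IntermediateField.mem_fixingSubgroup_iff]
      rw [SetLike.forall]
      refine forall_congr' fun x => forall_congr' fun hx => ?_
      have h0 : algebraMap (K i) Ω ⟨x, hx⟩ = algebraMap E Ω x := rfl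
      rw [h0, ← hrc, (algebraMap E Ω).injective.eq_iff]
    rw [this]
  have key : ∀ a, (∀ σ, r σ = 1 → P a σ) →
      (∀ σ, P a σ) ∨ ∃ i, ∀ σ, P a σ ↔ r σ ∈ (K i).fixingSubgroup := by
    intro a ha
    by_cases hall' : ∀ σ, P a σ
    · exact Or.inl hall'
    right
    push Not at hall'
    obtain ⟨ψ, hψ, hcyc⟩ := wlaux_char Ω ℓ hℓ k a
    obtain ⟨B, hB, hBi⟩ := wlaux_index p hp hV hcomm r hr ψ hcyc
      (fun σ h => (hψ σ).1 (ha σ h))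
      (by obtain ⟨σ, hσ⟩ := hall'; exact ⟨σ, fun h => hσ ((hψ σ).2 h)⟩)
    have hfin : finrank ℚ (IntermediateField.fixedField B) = p := by
      have h1 := IntermediateField.finrank_fixedField_eq_card B
      have h2 := Module.finrank_mul_finrank ℚ (IntermediateField.fixedField B) E
      have h3 := B.card_mul_index
      rw [IsGalois.card_aut_eq_finrank, ← h2, h1, hBi, mul_comm] at h3
      exact (Nat.eq_of_mul_eq_mul_right Nat.card_pos h3).symm
    obtain ⟨i, hi⟩ := hall _ hfin
    refine ⟨i, fun σ => ?_⟩
    rw [← hi, IntermediateField.fixingSubgroup_fixedField, ← hB]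
    exact hψ σ
  have hsub : ∀ i j, (K i).fixingSubgroup ≤ (K j).fixingSubgroup → i = j := by
    intro i j h
    have h1 := (IntermediateField.le_iff_le (K i).fixingSubgroup (K j)).2 h
    rw [IsGalois.fixedField_fixingSubgroup] at h1
    exact hinj (IntermediateField.eq_of_le_of_finrank_eq h1 (by rw [hdeg, hdeg])).symm
  have ht : (p ^ n - 1) / (p - 1) = (p ^ n - p) / (p - 1) + 1 := by
    have h2 := hp.two_le
    have h1 : p ≤ p ^ n := Nat.le_self_pow (by omega) p
    rw [← Nat.add_div_right _ (by omega)]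
    congr 1
    omega
  by_cases hc : ∀ a, (∀ σ, r σ = 1 → P a σ) → ∀ σ, P a σ
  · have e1 : wl E (2 * k) ℓ = wl ℚ (2 * k) ℓ := by
      rw [wE, wQ]
      congr 2
      ext a
      exact ⟨hc a, fun h σ _ => h σ⟩
    have e2 : ∀ i, wl (K i) (2 * k) ℓ = wl ℚ (2 * k) ℓ := by
      intro i
      rw [wK, wQ]
      congr 2
      ext a
      exact ⟨fun h => hc a fun σ hσ => h σ (by rw [hσ]; exact one_mem _), fun h σ _ => h σ⟩
    simp only [e1, e2, Finset.prod_const, Finset.card_univ, Fintype.card_fin]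
    rw [ht, pow_succ]
  · push Not at hc
    obtain ⟨a₀, ha₀, σ₀, hσ₀⟩ := hc
    obtain h | ⟨i, hi⟩ := key a₀ ha₀
    · exact absurd (h σ₀) hσ₀
    have hle : ∀ a, (∀ σ, r σ = 1 → P a σ) → ∀ σ, r σ ∈ (K i).fixingSubgroup → P a σ := by
      intro a ha σ hσ
      obtain h | ⟨j, hj⟩ := key a ha
      · exact h σ
      rcases le_total a a₀ with hh | hh
      · exact hmono _ _ hh σ ((hi σ).2 hσ)
      · have : j = i := hsub j i (fun v hv => by
          obtain ⟨τ, rfl⟩ := hr v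
          exact (hi τ).1 (hmono _ _ hh τ ((hj τ).2 hv)))
        rw [hj, this]; exact hσ
    have e1 : wl (K i) (2 * k) ℓ = wl E (2 * k) ℓ := by
      rw [wE, wK]
      congr 2
      ext a
      exact ⟨fun h σ hσ => h σ (by rw [hσ]; exact one_mem _), hle a⟩
    have e2 : ∀ j, j ≠ i → wl (K j) (2 * k) ℓ = wl ℚ (2 * k) ℓ := by
      intro j hji
      rw [wK, wQ]
      congr 2
      ext a
      refine ⟨fun h => ?_, fun h σ _ => h σ⟩
      have ha : ∀ σ, r σ = 1 → P a σ := fun σ hσ => h σ (by rw [hσ]; exact one_mem _)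
      obtain h' | ⟨m, hm⟩ := key a ha
      · exact h'
      exfalso
      apply hji
      have h1 : j = m := hsub j m (fun v hv => by
          obtain ⟨τ, rfl⟩ := hr v
          exact (hm τ).1 (h τ hv))
      have h2 : i = m := hsub i m (fun v hv => by
          obtain ⟨τ, rfl⟩ := hr v
          exact (hm τ).1 (hle a ha τ hv))
      rw [h1, h2]
    rw [← Finset.mul_prod_erase Finset.univ _ (Finset.mem_univ i), e1, mul_comm]
    congr 1
    rw [Finset.prod_congr rfl (fun j hj => e2 j (Finset.ne_of_mem_erase hj)), Finset.prod_const,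
      Finset.card_erase_of_mem (Finset.mem_univ i), Finset.card_univ, Fintype.card_fin, ht,
      Nat.add_sub_cancel]
end
end

section
/- Let p be a prime and n ≥ 2 an integer, and let E be a totally real Galois extension of ℚ with Gal(E/ℚ) ≅ (ℤ/pℤ)^{⊕n}. Let ℓ be an odd prime such that K := E ∩ ℚ(μ_ℓ) has degree p over ℚ (so that K ⊆ ℚ(μ_ℓ) and ℓ ≡ 1 (mod 2p)), and let k ≥ 1 be an integer such that (ℓ − 1)/p divides 2k but ℓ − 1 does not divide 2k. Then w_{2k}^{(ℓ)}(E) = w_{2k}^{(ℓ)}(K) = ℓ^{1 + v_ℓ(2k)}, while w_{2k}^{(ℓ)}(ℚ) = 1 and w_{2k}^{(ℓ)}(K′) = 1 for every subfield K′ ≠ K of E of degree p over ℚ. -/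
open scoped Classical
noncomputable section

open Module

/-- `ℚ(μ_ℓ)`, the `ℓ`-th cyclotomic field, viewed inside a fixed algebraic closure of `ℚ`. -/
def cycField (ℓ : ℕ) : IntermediateField ℚ (AlgebraicClosure ℚ) :=
  IntermediateField.adjoin ℚ {ζ : AlgebraicClosure ℚ | ζ ^ ℓ = 1}

local notation "QQ" => AlgebraicClosure ℚ

section helpers

/-- The intermediate-field algebra structure, preferred to the rational one. -/
local instance (priority := 5000) algInst (F : IntermediateField ℚ QQ) : Algebra ℚ ↥F :=
  IntermediateField.algebra' F

instance algQQ : Algebra.IsAlgebraic ℚ QQ := AlgebraicClosure.isAlgebraic ℚ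
instance closureQQ : IsAlgClosure ℚ QQ := ⟨inferInstance, inferInstance⟩
instance galoisQQ : IsGalois ℚ QQ := inferInstance
instance normalQQ : Normal ℚ QQ := inferInstance

/-- Uniqueness of the algebraic closure. -/
def closureEquiv (F L : Type*) [Field F] [Field L] [Algebra F L] [IsAlgClosure F L] :
    AlgebraicClosure F ≃ₐ[F] L := IsAlgClosure.equiv F _ _

/-- The condition defining `wl`, transported to the fixed algebraic closure of `ℚ`. -/
def Fixes (F : IntermediateField ℚ QQ) (j ℓ a : ℕ) : Prop :=
  ∀ σ ∈ F.fixingSubgroup, ∀ ζ : QQ, ζ ^ ℓ ^ a = 1 → (σ ^ j) ζ = ζ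

lemma wl_transfer (F : IntermediateField ℚ QQ) (j ℓ : ℕ) :
    wl ↥F j ℓ = ℓ ^ sSup {a : ℕ | Fixes F j ℓ a} := by
  unfold wl
  congr 2
  ext a
  have : IsAlgClosure ↥F QQ := ⟨inferInstance, inferInstance⟩
  let e : AlgebraicClosure ↥F ≃ₐ[↥F] QQ := closureEquiv ↥F QQ
  have key : ∀ (σ : AlgebraicClosure ↥F ≃ₐ[↥F] AlgebraicClosure ↥F) (j : ℕ) (x : QQ),
      (((e.symm.trans (σ.trans e)).restrictScalars ℚ) ^ j) x = e ((σ ^ j) (e.symm x)) := by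
    intro σ j
    induction j with
    | zero => intro x; simp
    | succ n ih =>
      intro x
      rw [pow_succ, AlgEquiv.mul_apply, ih, pow_succ, AlgEquiv.mul_apply]
      simp
  simp only [Set.mem_ofPred_eq, Fixes]
  constructor
  · intro h σ hσ ζ hζ
    let σ' : QQ ≃ₐ[↥F] QQ := AlgEquiv.ofRingEquiv (f := σ.toRingEquiv)
      (fun x => (IntermediateField.mem_fixingSubgroup_iff F σ).1 hσ _ x.2)
    have h2 := key (e.trans (σ'.trans e.symm)) j ζ
    have h3 : ((e.symm.trans ((e.trans (σ'.trans e.symm)).trans e)).restrictScalars ℚ) = σ := by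
      ext x
      simp [σ']
    rw [h3, h _ _ (by rw [← map_pow, hζ, map_one])] at h2
    simpa using h2
  · intro h σ ζ hζ
    have h2 := h ((e.symm.trans (σ.trans e)).restrictScalars ℚ) (by
      rw [IntermediateField.mem_fixingSubgroup_iff]
      intro x hx
      exact (e.symm.trans (σ.trans e)).commutes ⟨x, hx⟩) (e ζ) (by rw [← map_pow, hζ, map_one])
    rw [key] at h2
    simpa using h2

lemma wl_transfer_rat (j ℓ : ℕ) :
    wl ℚ j ℓ = ℓ ^ sSup {a : ℕ | Fixes ⊥ j ℓ a} := by
  unfold wl Fixes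
  simp only [IntermediateField.fixingSubgroup_bot, Subgroup.mem_top, forall_const]
  rfl

lemma exists_conj_s4 {n m : ℕ} (hn : 0 < n) {ζ : QQ} (hζ : IsPrimitiveRoot ζ n)
    (hm : m.Coprime n) : ∃ τ : QQ ≃ₐ[ℚ] QQ, τ ζ = ζ ^ m := by
  have h : IsConjRoot ℚ (ζ ^ m) ζ := by
    unfold IsConjRoot
    rw [← Polynomial.cyclotomic_eq_minpoly_rat hζ hn,
      ← Polynomial.cyclotomic_eq_minpoly_rat (hζ.pow_of_coprime m hm) hn]
  exact isConjRoot_iff_exists_algEquiv.1 h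

lemma gal_pow_apply {τ : QQ ≃ₐ[ℚ] QQ} {ζ : QQ} {m : ℕ} (h : τ ζ = ζ ^ m) (j : ℕ) :
    (τ ^ j) ζ = ζ ^ m ^ j := by
  induction j with
  | zero => simp
  | succ n ih => rw [pow_succ, AlgEquiv.mul_apply, h, map_pow, ih, ← pow_mul, pow_succ]

lemma exists_prim {n : ℕ} (hn : 0 < n) : ∃ ζ : QQ, IsPrimitiveRoot ζ n := by
  have : NeZero n := ⟨hn.ne'⟩
  exact HasEnoughRootsOfUnity.exists_primitiveRoot QQ n

lemma cyc_eq {ℓ : ℕ} (h : 0 < ℓ) {ζ : QQ} (hζ : IsPrimitiveRoot ζ ℓ) :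
    cycField ℓ = IntermediateField.adjoin ℚ {ζ} := by
  unfold cycField
  apply le_antisymm
  · rw [IntermediateField.adjoin_le_iff]
    intro x hx
    have : NeZero ℓ := ⟨h.ne'⟩
    obtain ⟨i, _, rfl⟩ := hζ.eq_pow_of_pow_eq_one hx
    exact pow_mem (IntermediateField.mem_adjoin_simple_self ℚ ζ) i
  · rw [IntermediateField.adjoin_simple_le_iff]
    exact IntermediateField.subset_adjoin _ _ hζ.pow_eq_one

lemma cyc_isCyc {ℓ : ℕ} (h : 0 < ℓ) : IsCyclotomicExtension {ℓ} ℚ ↥(cycField ℓ) := by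
  obtain ⟨ζ, hζ⟩ := exists_prim h
  have : NeZero ℓ := ⟨h.ne'⟩
  rw [cyc_eq h hζ]
  exact hζ.intermediateField_adjoin_isCyclotomicExtension ℚ

lemma cyc_finite {ℓ : ℕ} (h : 0 < ℓ) : FiniteDimensional ℚ ↥(cycField ℓ) := by
  have := cyc_isCyc h
  exact IsCyclotomicExtension.finiteDimensional {ℓ} ℚ _

lemma cyc_galois {ℓ : ℕ} (h : 0 < ℓ) : IsGalois ℚ ↥(cycField ℓ) := by
  have := cyc_isCyc h
  exact IsCyclotomicExtension.isGalois {ℓ} ℚ _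

lemma cyc_finrank {ℓ : ℕ} (h : ℓ.Prime) : finrank ℚ ↥(cycField ℓ) = ℓ - 1 := by
  have := cyc_isCyc h.pos
  have : NeZero ℓ := ⟨h.pos.ne'⟩
  rw [IsCyclotomicExtension.finrank (n := ℓ) _ (Polynomial.cyclotomic.irreducible_rat h.pos),
    Nat.totient_prime h]

/-- Over a field meeting `ℚ(μ_ℓ)` trivially, the full Galois group is realised. -/
lemma exists_lift {ℓ : ℕ} (hℓ : ℓ.Prime) (F : IntermediateField ℚ QQ)
    (hF : F ⊓ cycField ℓ = ⊥) (τ : QQ ≃ₐ[ℚ] QQ) :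
    ∃ σ ∈ F.fixingSubgroup, ∀ x ∈ cycField ℓ, σ x = τ x := by
  have := cyc_finite hℓ.pos
  have := cyc_galois hℓ.pos
  have h1 := InfiniteGalois.restrict_fixedField F.fixingSubgroup (cycField ℓ)
  rw [InfiniteGalois.fixedField_fixingSubgroup, hF] at h1
  have h2 : IntermediateField.fixedField
      (Subgroup.map (AlgEquiv.restrictNormalHom (cycField ℓ)) F.fixingSubgroup) = ⊥ := by
    apply IntermediateField.lift_injective
    rw [← h1, IntermediateField.lift_bot]
  have h3 := IntermediateField.fixingSubgroup_fixedField
    (Subgroup.map (AlgEquiv.restrictNormalHom (cycField ℓ)) F.fixingSubgroup)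
  rw [h2, IntermediateField.fixingSubgroup_bot] at h3
  have h4 : AlgEquiv.restrictNormalHom (cycField ℓ) τ ∈
      Subgroup.map (AlgEquiv.restrictNormalHom (cycField ℓ)) F.fixingSubgroup := by
    rw [← h3]; trivial
  obtain ⟨σ, hσ, h5⟩ := h4
  refine ⟨σ, hσ, fun x hx => ?_⟩
  have h6 := AlgEquiv.restrictNormal_commutes σ (cycField ℓ) ⟨x, hx⟩
  have h7 := AlgEquiv.restrictNormal_commutes τ (cycField ℓ) ⟨x, hx⟩
  have h8 : σ.restrictNormal (cycField ℓ) = τ.restrictNormal (cycField ℓ) := h5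
  rw [h8] at h6
  exact h6.symm.trans h7

lemma prim_pow_iff {n m : ℕ} (hn : 0 < n) {ζ : QQ} (hζ : IsPrimitiveRoot ζ n) :
    ζ ^ m = ζ ↔ (m : ZMod n) = 1 := by
  have : NeZero n := ⟨hn.ne'⟩
  have h1 : ζ ^ m = ζ ↔ m ≡ 1 [MOD n] := by
    have := (hζ.isOfFinOrder (NeZero.ne n)).pow_eq_pow_iff_modEq (m := 1) (n := m)
    rw [← hζ.eq_orderOf, pow_one] at this
    exact this
  rw [h1, ← ZMod.natCast_eq_natCast_iff, Nat.cast_one]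

lemma sSup_fixes_zero {ℓ : ℕ} (hℓ : ℓ.Prime) (F : IntermediateField ℚ QQ)
    (hF : F ⊓ cycField ℓ = ⊥) {j : ℕ} (hj : ¬ (ℓ - 1) ∣ j) :
    sSup {a : ℕ | Fixes F j ℓ a} = 0 := by
  have hz : ∀ a, Fixes F j ℓ a → a = 0 := by
    intro a ha
    by_contra ha0
    have : Fact ℓ.Prime := ⟨hℓ⟩
    obtain ⟨ζ, hζ⟩ := exists_prim hℓ.pos
    obtain ⟨g, hg⟩ := IsCyclic.exists_ofOrder_eq_natCard (α := (ZMod ℓ)ˣ)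
    rw [Nat.card_eq_fintype_card, ZMod.card_units] at hg
    obtain ⟨τ, hτ⟩ := exists_conj_s4 hℓ.pos hζ (ZMod.val_coe_unit_coprime g)
    obtain ⟨σ, hσ, hs⟩ := exists_lift hℓ F hF τ
    have h1 : σ ζ = ζ ^ (g : ZMod ℓ).val := by
      rw [hs ζ (IntermediateField.subset_adjoin _ _ hζ.pow_eq_one), hτ]
    have h2 := ha σ hσ ζ (by
      obtain ⟨b, rfl⟩ := Nat.exists_eq_succ_of_ne_zero ha0
      rw [Nat.succ_eq_add_one, pow_succ', pow_mul, hζ.pow_eq_one, one_pow])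
    rw [gal_pow_apply h1, prim_pow_iff hℓ.pos hζ] at h2
    apply hj
    rw [← hg, orderOf_dvd_iff_pow_eq_one]
    ext
    simpa using h2
  have : {a : ℕ | Fixes F j ℓ a} ⊆ {0} := fun a ha => hz a ha
  rcases Set.subset_singleton_iff_eq.1 this with h | h <;> simp [h]

lemma fix_zeta {ℓ p : ℕ} (hℓ : ℓ.Prime) (K : IntermediateField ℚ QQ) (hK : K ≤ cycField ℓ)
    (hp : 0 < p) (hdeg : finrank ℚ ↥K = p) :
    p ∣ ℓ - 1 ∧ ∀ σ ∈ K.fixingSubgroup, ∀ x ∈ cycField ℓ, (σ ^ ((ℓ - 1) / p)) x = x := by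
  have := cyc_finite hℓ.pos
  have := cyc_galois hℓ.pos
  have h1 := finrank_mul_finrank ℚ ↥(IntermediateField.restrict hK) ↥(cycField ℓ)
  rw [cyc_finrank hℓ, ← (IntermediateField.restrictAlgEquiv hK).toLinearEquiv.finrank_eq, hdeg,
    ← IsGalois.card_fixingSubgroup_eq_finrank] at h1
  refine ⟨⟨_, h1.symm⟩, ?_⟩
  intro σ hσ x hx
  have h2 : AlgEquiv.restrictNormalHom (cycField ℓ) σ ∈
      (IntermediateField.restrict hK).fixingSubgroup := by
    rw [IntermediateField.mem_fixingSubgroup_iff]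
    intro y hy
    apply Subtype.ext
    rw [← (IntermediateField.mem_fixingSubgroup_iff K σ).1 hσ y
      ((IntermediateField.mem_restrict hK y).1 hy)]
    exact AlgEquiv.restrictNormal_commutes σ (cycField ℓ) y
  have h3 : (AlgEquiv.restrictNormalHom (cycField ℓ) σ) ^ ((ℓ - 1) / p) = 1 := by
    rw [← h1, Nat.mul_div_cancel_left _ hp]
    exact congrArg Subtype.val (pow_card_eq_one' (x := (⟨_, h2⟩ : (IntermediateField.restrict hK).fixingSubgroup)))
  rw [← map_pow] at h3
  have h4 := AlgEquiv.restrictNormal_commutes (σ ^ ((ℓ - 1) / p)) (cycField ℓ) ⟨x, hx⟩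
  have h5 : (σ ^ ((ℓ - 1) / p)).restrictNormal (cycField ℓ) = 1 := h3
  rw [h5] at h4
  exact h4.symm

lemma fixes_lower {ℓ p j : ℕ} (hℓ : ℓ.Prime) (K : IntermediateField ℚ QQ) (hK : K ≤ cycField ℓ)
    (hp : 0 < p) (hdeg : finrank ℚ ↥K = p) (hj : (ℓ - 1) / p ∣ j) :
    Fixes K j ℓ (1 + padicValNat ℓ j) := by
  obtain ⟨hpd, hfix⟩ := fix_zeta hℓ K hK hp hdeg
  intro σ hσ ξ hξ
  have : Fact ℓ.Prime := ⟨hℓ⟩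
  set v := padicValNat ℓ j with hv
  have hpos : 0 < ℓ ^ (1 + v) := pow_pos hℓ.pos _
  have : NeZero (ℓ ^ (1 + v)) := ⟨hpos.ne'⟩
  obtain ⟨ζ, hζ⟩ := exists_prim hpos
  have hmpos : 0 < (ℓ - 1) / p :=
    Nat.div_pos (Nat.le_of_dvd (by have := hℓ.two_le; omega) hpd) hp
  have hmlt : (ℓ - 1) / p < ℓ := lt_of_le_of_lt (Nat.div_le_self _ _) (by have := hℓ.pos; omega)
  set m := (ℓ - 1) / p with hm
  have hdv : m * ℓ ^ v ∣ j := by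
    apply Nat.Coprime.mul_dvd_of_dvd_of_dvd _ hj pow_padicValNat_dvd
    exact Nat.Coprime.pow_right _ ((hℓ.coprime_iff_not_dvd.2 (Nat.not_dvd_of_pos_of_lt hmpos hmlt)).symm)
  set τ := σ ^ m with hτ
  obtain ⟨u, _, hu⟩ := hζ.eq_pow_of_pow_eq_one (ξ := τ ζ) (by
    rw [← map_pow, hζ.pow_eq_one, map_one])
  have hζ1 : IsPrimitiveRoot (ζ ^ ℓ ^ v) ℓ := hζ.pow hpos (by rw [pow_add, pow_one, mul_comm])
  have h1 : (ζ ^ ℓ ^ v) ^ u = ζ ^ ℓ ^ v := by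
    have := hfix σ hσ (ζ ^ ℓ ^ v) (IntermediateField.subset_adjoin _ _ hζ1.pow_eq_one)
    rw [map_pow, ← hu, pow_right_comm] at this
    exact this
  rw [prim_pow_iff hℓ.pos hζ1] at h1
  have h2 : (ℓ : ℤ) ∣ (u : ℤ) - 1 := by
    rw [← ZMod.intCast_zmod_eq_zero_iff_dvd]
    push_cast
    rw [h1, sub_self]
  have h3 := dvd_sub_pow_of_dvd_sub h2 v
  have h4 : (τ ^ ℓ ^ v) ζ = ζ := by
    rw [gal_pow_apply hu.symm, prim_pow_iff hpos hζ]
    rw [← Nat.cast_pow, ← ZMod.intCast_zmod_eq_zero_iff_dvd] at h3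
    push_cast at h3
    rw [one_pow, sub_eq_zero] at h3
    rw [add_comm 1 v]
    exact_mod_cast h3
  obtain ⟨c, hc⟩ := hdv
  obtain ⟨i, _, rfl⟩ := hζ.eq_pow_of_pow_eq_one hξ
  rw [hc, pow_mul, pow_mul, ← hτ, map_pow]
  congr 1
  have h5 := gal_pow_apply (m := 1) (by rw [h4, pow_one]) c
  rw [h5, one_pow, pow_one]

lemma fixes_upper {ℓ p j a : ℕ} (hℓ : ℓ.Prime) (hℓ2 : ℓ ≠ 2) (E : IntermediateField ℚ QQ)
    (hE : ∀ τ : QQ ≃ₐ[ℚ] QQ, ∀ x ∈ E, (τ ^ p) x = x) (hcop : ℓ.Coprime p) (hj : j ≠ 0)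
    (h : Fixes E j ℓ a) : a ≤ 1 + padicValNat ℓ j := by
  by_contra! hlt
  have : Fact ℓ.Prime := ⟨hℓ⟩
  set v := padicValNat ℓ j with hv
  have hpos : 0 < ℓ ^ (v + 1 + 1) := pow_pos hℓ.pos _
  obtain ⟨ζ, hζ⟩ := exists_prim hpos
  obtain ⟨τ, hτ⟩ := exists_conj_s4 (m := 1 + ℓ) hpos hζ (by
    apply Nat.Coprime.pow_right; simp)
  have hmem : τ ^ p ∈ E.fixingSubgroup := by
    rw [IntermediateField.mem_fixingSubgroup_iff]
    intro x hx
    exact hE τ x hx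
  have h1 := h _ hmem ζ (by
    obtain ⟨b, rfl⟩ := Nat.exists_eq_add_of_le (show v + 1 + 1 ≤ a by omega)
    rw [pow_add, pow_mul, hζ.pow_eq_one, one_pow])
  rw [← pow_mul, gal_pow_apply hτ, prim_pow_iff hpos hζ] at h1
  push_cast at h1
  rw [← orderOf_dvd_iff_pow_eq_one, ZMod.orderOf_one_add_prime hℓ hℓ2] at h1
  have h2 := (Nat.Coprime.pow_left (v + 1) hcop).dvd_of_dvd_mul_left h1
  exact pow_succ_padicValNat_not_dvd hj h2

end helpers

theorem wl_of_p_elementary_meet_cyclotomic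
    (p n : ℕ) (hp : p.Prime) (hn : 2 ≤ n)
    (E : IntermediateField ℚ (AlgebraicClosure ℚ))
    [FiniteDimensional ℚ ↥E] [IsGalois ℚ ↥E]
    (hreal : IsTotallyReal ↥E)
    (giso : (↥E ≃ₐ[ℚ] ↥E) ≃* Multiplicative (Fin n → ZMod p))
    (ℓ : ℕ) (hℓ : ℓ.Prime) (hℓ2 : ℓ ≠ 2)
    (hdeg : finrank ℚ ↥(E ⊓ cycField ℓ) = p)
    (k : ℕ) (hk : 1 ≤ k)
    (hdvd : (ℓ - 1) / p ∣ 2 * k) (hndvd : ¬ (ℓ - 1) ∣ 2 * k) :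
    wl ↥E (2 * k) ℓ = ℓ ^ (1 + padicValNat ℓ (2 * k)) ∧
    wl ↥(E ⊓ cycField ℓ) (2 * k) ℓ = ℓ ^ (1 + padicValNat ℓ (2 * k)) ∧
    wl ℚ (2 * k) ℓ = 1 ∧
    ∀ K' : IntermediateField ℚ (AlgebraicClosure ℚ), K' ≤ E → finrank ℚ ↥K' = p →
      K' ≠ E ⊓ cycField ℓ → wl ↥K' (2 * k) ℓ = 1 := by
  have hE : ∀ τ : ↥E ≃ₐ[ℚ] ↥E, τ ^ p = 1 := by
    intro τ
    apply giso.injective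
    rw [map_pow, map_one]
    apply Multiplicative.toAdd.injective
    rw [toAdd_pow, toAdd_one]
    ext i
    simp
  have hE' : ∀ τ : QQ ≃ₐ[ℚ] QQ, ∀ x ∈ E, (τ ^ p) x = x := by
    intro τ x hx
    have h4 := AlgEquiv.restrictNormal_commutes (τ ^ p) E ⟨x, hx⟩
    have h5 : (τ ^ p).restrictNormal E = 1 := by
      change AlgEquiv.restrictNormalHom E (τ ^ p) = 1
      rw [map_pow, hE]
    rw [h5] at h4
    exact h4.symm
  obtain ⟨hpd, -⟩ := fix_zeta hℓ (E ⊓ cycField ℓ) inf_le_right hp.pos hdeg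
  have hlt : p < ℓ := by
    have := Nat.le_of_dvd (by have := hℓ.two_le; omega) hpd
    have := hℓ.pos
    omega
  have hcop : ℓ.Coprime p := hℓ.coprime_iff_not_dvd.2 (Nat.not_dvd_of_pos_of_lt hp.pos hlt)
  have hj : 2 * k ≠ 0 := by omega
  have hlow := fixes_lower hℓ (E ⊓ cycField ℓ) inf_le_right hp.pos hdeg hdvd
  have hmono : ∀ a, Fixes (E ⊓ cycField ℓ) (2 * k) ℓ a → Fixes E (2 * k) ℓ a :=
    fun a h σ hσ => h σ (IntermediateField.fixingSubgroup_le inf_le_left hσ)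
  have hup : ∀ a, Fixes E (2 * k) ℓ a → a ≤ 1 + padicValNat ℓ (2 * k) :=
    fun a h => fixes_upper hℓ hℓ2 E hE' hcop hj h
  refine ⟨?_, ?_, ?_, ?_⟩
  · rw [wl_transfer]
    congr 1
    exact IsGreatest.csSup_eq ⟨hmono _ hlow, fun a h => hup a h⟩
  · rw [wl_transfer]
    congr 1
    exact IsGreatest.csSup_eq ⟨hlow, fun a h => hup a (hmono a h)⟩
  · rw [wl_transfer_rat, sSup_fixes_zero hℓ ⊥ (bot_inf_eq _) hndvd, pow_zero]
  · intro K' hK' hd hne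
    rw [wl_transfer, sSup_fixes_zero hℓ K' ?_ hndvd, pow_zero]
    have hfK' : FiniteDimensional ℚ ↥K' := FiniteDimensional.of_finrank_pos (hd ▸ hp.pos)
    have hfK : FiniteDimensional ℚ ↥(E ⊓ cycField ℓ) :=
      FiniteDimensional.of_finrank_pos (hdeg ▸ hp.pos)
    have hle : K' ⊓ cycField ℓ ≤ E ⊓ cycField ℓ := inf_le_inf_right _ hK'
    have hdd : finrank ℚ ↥(K' ⊓ cycField ℓ) ∣ p := by
      rw [← hd]
      exact IntermediateField.finrank_dvd_of_le_right inf_le_left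
    rcases (Nat.dvd_prime hp).1 hdd with h | h
    · exact IntermediateField.finrank_eq_one_iff.1 h
    · exfalso
      apply hne
      have e1 : K' ⊓ cycField ℓ = K' :=
        IntermediateField.eq_of_le_of_finrank_eq inf_le_left (by rw [h, hd])
      have e2 : K' ⊓ cycField ℓ = E ⊓ cycField ℓ :=
        IntermediateField.eq_of_le_of_finrank_eq hle (by rw [h, hdeg])
      rw [← e2, e1]
end
end

section
/- Let L be a totally real number field with √2 ∉ L. Then for every integer k ≥ 1 one has w_{2k}^{(2)}(L) = 2^{2 + v_2(2k)} = 2^{3 + v_2(k)}. -/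
open scoped Classical
noncomputable section

lemma aux_val (c k : ℕ) (hc : 1 < c) (ho : Odd c) (hk : 1 ≤ k) :
    padicValNat 2 (c ^ (2 * k) - 1) + 1 =
      padicValNat 2 (c + 1) + padicValNat 2 (c - 1) + padicValNat 2 (2 * k) := by
  have h := padicValNat.pow_two_sub_pow (x := c) (y := 1) hc (by obtain ⟨t, rfl⟩ := ho; omega)
    (by obtain ⟨t, rfl⟩ := ho; omega) (n := 2 * k) (by omega) (even_two_mul k)
  simpa using h

lemma aux_odd (t : ℕ) (h : t ≠ 0) :
    padicValNat 2 (2 * t) = padicValNat 2 t + 1 := by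
  rw [padicValNat.mul (by norm_num) h, padicValNat_self, add_comm]

lemma aux_A (c k : ℕ) (ho : Odd c) (hk : 1 ≤ k) :
    2 ^ (2 + padicValNat 2 (2 * k)) ∣ c ^ (2 * k) - 1 := by
  obtain ⟨t, rfl⟩ := ho
  rcases Nat.eq_zero_or_pos t with rfl | ht
  · simp
  have h := aux_val (2 * t + 1) k (by omega) ⟨t, rfl⟩ hk
  have e1 : 2 * t + 1 + 1 = 2 * (t + 1) := by ring
  rw [e1, Nat.add_sub_cancel, aux_odd _ (by omega), aux_odd _ (by omega)] at h
  have h2 : 1 ≤ padicValNat 2 (t + 1) + padicValNat 2 t := by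
    rcases Nat.even_or_odd t with h' | h'
    · have := one_le_padicValNat_of_dvd (p := 2) (n := t) (by omega) h'.two_dvd
      omega
    · have := one_le_padicValNat_of_dvd (p := 2) (n := t + 1) (by omega) (h'.add_one).two_dvd
      omega
  exact (pow_dvd_pow 2 (by omega)).trans pow_padicValNat_dvd

lemma aux_B (c k a : ℕ) (h8 : c % 8 = 3 ∨ c % 8 = 5) (hk : 1 ≤ k)
    (hd : 2 ^ a ∣ c ^ (2 * k) - 1) : a ≤ 2 + padicValNat 2 (2 * k) := by
  have h := aux_val c k (by omega) (Nat.odd_iff.mpr (by omega)) hk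
  have hz (x : ℕ) (hx : x % 2 = 1) : padicValNat 2 x = 0 :=
    padicValNat.eq_zero_of_not_dvd (by omega)
  have key : padicValNat 2 (c + 1) + padicValNat 2 (c - 1) = 3 := by
    rcases h8 with h8 | h8
    · obtain ⟨u, rfl⟩ : ∃ u, c = 8 * u + 3 := ⟨c / 8, by omega⟩
      rw [show 8 * u + 3 + 1 = 2 * (2 * (2 * u + 1)) by ring,
        show 8 * u + 3 - 1 = 2 * (4 * u + 1) by omega,
        aux_odd _ (by omega), aux_odd _ (by omega), aux_odd _ (by omega),
        hz _ (by omega), hz _ (by omega)]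
    · obtain ⟨u, rfl⟩ : ∃ u, c = 8 * u + 5 := ⟨c / 8, by omega⟩
      rw [show 8 * u + 5 + 1 = 2 * (4 * u + 3) by ring,
        show 8 * u + 5 - 1 = 2 * (2 * (2 * u + 1)) by omega,
        aux_odd _ (by omega), aux_odd _ (by omega), aux_odd _ (by omega),
        hz _ (by omega), hz _ (by omega)]
  have hne : c ^ (2 * k) - 1 ≠ 0 := by
    have : 1 < c ^ (2 * k) := Nat.one_lt_pow (by omega) (by omega)
    omega
  have := (padicValNat_dvd_iff_le hne).mp hd
  omega

lemma aux_gal {F : Type*} [Field F] (σ : AlgebraicClosure F ≃ₐ[F] AlgebraicClosure F)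
    {a : ℕ} (ha : 1 ≤ a) {ζ : AlgebraicClosure F} (hζ : IsPrimitiveRoot ζ (2 ^ a)) :
    ∃ c : ℕ, Odd c ∧ ∀ m : ℕ, (σ ^ m) ζ = ζ ^ c ^ m := by
  have h1 : IsPrimitiveRoot (σ ζ) (2 ^ a) := hζ.map_of_injective σ.injective
  have : NeZero (2 ^ a) := ⟨by positivity⟩
  obtain ⟨c, -, hc⟩ := hζ.eq_pow_of_pow_eq_one h1.pow_eq_one
  rw [← hc, hζ.pow_iff_coprime (by positivity)] at h1
  refine ⟨c, ?_, ?_⟩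
  · have := Nat.Coprime.coprime_dvd_right (dvd_pow_self 2 (by omega)) h1
    exact Nat.coprime_two_right.mp this
  · intro m
    induction m with
    | zero => simp
    | succ m ih =>
      rw [pow_succ, AlgEquiv.mul_apply, ← hc, map_pow, ih, ← pow_mul, pow_succ]

lemma aux_fix {K : Type*} [Field K] {ζ : K} {N c : ℕ} (hζ : IsPrimitiveRoot ζ N)
    (hN : 0 < N) (hc : 1 ≤ c) : ζ ^ c = ζ ↔ N ∣ c - 1 := by
  rw [← hζ.pow_eq_one_iff_dvd]
  have h0 : ζ ≠ 0 := hζ.ne_zero hN.ne'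
  obtain ⟨d, rfl⟩ : ∃ d, c = d + 1 := ⟨c - 1, by omega⟩
  rw [pow_succ, Nat.add_sub_cancel]
  exact mul_eq_right₀ h0

theorem wl_two_of_totallyReal_no_sqrt_two
    (L : Type*) [Field L] [NumberField L] (hreal : IsTotallyReal L)
    (hsqrt2 : ¬ ∃ x : L, x ^ 2 = 2)
    (k : ℕ) (hk : 1 ≤ k) :
    wl L (2 * k) 2 = 2 ^ (2 + padicValNat 2 (2 * k)) ∧
    (2 : ℕ) ^ (2 + padicValNat 2 (2 * k)) = 2 ^ (3 + padicValNat 2 k) := by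
  have hval : padicValNat 2 (2 * k) = padicValNat 2 k + 1 := aux_odd k (by omega)
  refine ⟨?_, by rw [hval]; congr 1; omega⟩
  unfold wl
  congr 1
  apply IsGreatest.csSup_eq
  constructor
  · intro σ ζ hζ
    obtain ⟨ξ, hξ⟩ := HasEnoughRootsOfUnity.exists_primitiveRoot (AlgebraicClosure L)
      (2 ^ (2 + padicValNat 2 (2 * k)))
    have : NeZero (2 ^ (2 + padicValNat 2 (2 * k))) := ⟨by positivity⟩
    obtain ⟨i, -, rfl⟩ := hξ.eq_pow_of_pow_eq_one hζ
    obtain ⟨c, hc, hm⟩ := aux_gal σ (by omega) hξ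
    rw [map_pow, hm, (aux_fix hξ (by positivity) (Nat.one_le_pow _ _ hc.pos)).mpr
      (aux_A c k hc hk)]
  · intro a ha
    by_contra hlt
    push Not at hlt
    obtain ⟨ζ, hζ⟩ := HasEnoughRootsOfUnity.exists_primitiveRoot (AlgebraicClosure L) (2 ^ a)
    obtain ⟨b, rfl⟩ : ∃ b, a = b + 3 := ⟨a - 3, by omega⟩
    have hω : IsPrimitiveRoot (ζ ^ 2 ^ b) 8 :=
      hζ.pow (by positivity) (by rw [pow_add]; norm_num)
    set ω := ζ ^ 2 ^ b with hωdef
    have hω4 : ω ^ 4 = -1 := by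
      have h8 := hω.pow_eq_one
      have h4 : ω ^ 4 ≠ 1 := hω.pow_ne_one_of_pos_of_lt (by norm_num) (by norm_num)
      have : (ω ^ 4 - 1) * (ω ^ 4 + 1) = 0 := by linear_combination h8
      rcases mul_eq_zero.mp this with h | h
      · exact absurd (sub_eq_zero.mp h) h4
      · exact eq_neg_of_add_eq_zero_left h
    have hs : (ω + ω ^ 7) ^ 2 = 2 := by
      linear_combination (ω ^ 10 - ω ^ 6 + 2 * ω ^ 4 + ω ^ 2 - 2) * hω4
    have hex : ∃ σ : AlgebraicClosure L ≃ₐ[L] AlgebraicClosure L,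
        σ (ω + ω ^ 7) ≠ ω + ω ^ 7 := by
      by_contra hall
      push Not at hall
      obtain ⟨x, hx⟩ := (InfiniteGalois.mem_range_algebraMap_iff_fixed
        (k := L) (ω + ω ^ 7)).mpr hall
      refine hsqrt2 ⟨x, (algebraMap L (AlgebraicClosure L)).injective ?_⟩
      rw [map_pow, hx, hs, map_ofNat]
    obtain ⟨σ, hσ⟩ := hex
    obtain ⟨c, hc, hm⟩ := aux_gal σ (by omega) hζ
    have h1 : σ ω = ω ^ c := by
      have := hm 1
      rw [pow_one, pow_one] at this
      rw [hωdef, map_pow, this, ← pow_mul, ← pow_mul, mul_comm]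
    have h2 : σ ω = ω ^ (c % 8) := by
      rw [h1, pow_eq_pow_mod c hω.pow_eq_one]
    have h8 : c % 8 = 3 ∨ c % 8 = 5 := by
      have hc2 := Nat.odd_iff.mp hc
      have : c % 8 = 1 ∨ c % 8 = 3 ∨ c % 8 = 5 ∨ c % 8 = 7 := by omega
      rcases this with h | h | h | h
      · exact absurd (by rw [map_add, map_pow σ ω 7, h2, h, pow_one]) hσ
      · exact Or.inl h
      · exact Or.inr h
      · refine absurd ?_ hσ
        rw [map_add, map_pow σ ω 7, h2, h, ← pow_mul ω 7 7, pow_eq_pow_mod (7 * 7) hω.pow_eq_one]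
        norm_num
        ring
    have h3 := ha σ ζ hζ.pow_eq_one
    rw [hm, aux_fix hζ (by positivity) (Nat.one_le_pow _ _ hc.pos)] at h3
    exact absurd (aux_B c k _ h8 hk h3) (by omega)
end
end

section
/- Let n ≥ 1 be an integer and let E be a totally real Galois extension of ℚ with Gal(E/ℚ) ≅ (ℤ/2ℤ)^{⊕n} and √2 ∈ E. Then for every integer k ≥ 1 one has w_{2k}^{(2)}(E) = 2^{3 + v_2(2k)} = 2^{4 + v_2(k)}. -/
open scoped Classical
noncomputable section

theorem aux_lte (c k b : ℕ) (hc : Odd c) (hk : 1 ≤ k) :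
    (2 : ℤ) ^ (b + padicValNat 2 k) ∣ (c : ℤ) ^ (2 * k) - 1 ↔ (2 : ℤ) ^ b ∣ (c : ℤ) ^ 2 - 1 := by
  have hc' : Odd (c : ℤ) := by exact_mod_cast hc
  have h4 : (4 : ℤ) ∣ (c : ℤ) ^ 2 - 1 := by
    have := Int.sq_mod_four_eq_one_of_odd hc'
    omega
  have h2 : ¬ (2 : ℤ) ∣ (c : ℤ) ^ 2 := by omega
  have key := Int.two_pow_sub_pow' (x := (c : ℤ) ^ 2) (y := 1) k h4 h2
  have hv : emultiplicity (2 : ℤ) (k : ℤ) = (padicValNat 2 k : ℕ∞) := by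
    rw [padicValNat_eq_emultiplicity (by omega)]
    exact_mod_cast Int.natCast_emultiplicity 2 k
  rw [one_pow, hv, ← pow_mul] at key
  rw [pow_dvd_iff_le_emultiplicity, pow_dvd_iff_le_emultiplicity, key]
  push_cast
  exact ENat.add_le_add_iff_right (ENat.natCast_ne_top _)

theorem aux_pow {F K : Type*} [Field F] [Field K] [Algebra F K] (σ : K ≃ₐ[F] K) (ξ : K) (c : ℕ)
    (h : σ ξ = ξ ^ c) (j : ℕ) : (σ ^ j) ξ = ξ ^ (c ^ j) := by
  induction j with
  | zero => simp
  | succ j ih => rw [pow_succ', AlgEquiv.mul_apply, ih, map_pow, h, ← pow_mul, pow_succ']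

theorem aux_sym {K : Type*} [Field K] (η θ : K) (h1 : η ≠ 0) (h2 : θ ≠ 0)
    (h : η + η⁻¹ = θ + θ⁻¹) : θ = η ∨ θ * η = 1 := by
  field_simp at h
  have : (θ - η) * (θ * η - 1) = 0 := by linear_combination -h
  rcases mul_eq_zero.1 this with h | h
  · left; linear_combination h
  · right; linear_combination h

theorem aux_mod {K : Type*} [Field K] (η : K) (m : ℕ) [h0 : NeZero m] (hη : IsPrimitiveRoot η m)
    (c d : ℕ) : η ^ c = η ^ d ↔ (m : ℤ) ∣ (c : ℤ) - d := by
  have hη0 : η ≠ 0 := hη.ne_zero h0.out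
  rw [← hη.zpow_eq_one_iff_dvd, zpow_sub₀ hη0, zpow_natCast, zpow_natCast,
    div_eq_one_iff_eq (pow_ne_zero _ hη0)]

theorem aux_lower {E : Type*} [Field E] [CharZero E] (hsqrt2 : ∃ x : E, x ^ 2 = 2)
    (k : ℕ) (hk : 1 ≤ k) (σ : AlgebraicClosure E ≃ₐ[E] AlgebraicClosure E)
    (ζ : AlgebraicClosure E) (hζ : ζ ^ 2 ^ (4 + padicValNat 2 k) = 1) : (σ ^ (2 * k)) ζ = ζ := by
  obtain ⟨x, hx⟩ := hsqrt2
  set a := 4 + padicValNat 2 k with ha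
  obtain ⟨ξ, hξ⟩ := HasEnoughRootsOfUnity.exists_primitiveRoot (AlgebraicClosure E) (2 ^ a)
  have hξ0 : ξ ≠ 0 := hξ.ne_zero (by positivity)
  obtain ⟨c, -, hc⟩ := hξ.eq_pow_of_pow_eq_one (ξ := σ ξ) (by rw [← map_pow, hξ.pow_eq_one, map_one])
  obtain ⟨i, -, hi⟩ := hξ.eq_pow_of_pow_eq_one hζ
  have hη : IsPrimitiveRoot (ξ ^ 2 ^ (a - 3)) 8 := by
    refine hξ.pow (by positivity) ?_
    rw [show (8 : ℕ) = 2 ^ 3 by norm_num, ← pow_add]; congr 1; omega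
  set η := ξ ^ 2 ^ (a - 3) with hηd
  have hη0 : η ≠ 0 := pow_ne_zero _ hξ0
  have hση : σ η = η ^ c := by
    rw [hηd, map_pow, ← hc, ← pow_mul, ← pow_mul, mul_comm]
  have h4 : η ^ 4 = -1 := by
    have : (η ^ 4) ^ 2 = 1 := by rw [← pow_mul]; exact hη.pow_eq_one
    rcases (show _ ∨ _ from by simpa using this) with h | h
    · exact absurd h (hη.pow_ne_one_of_pos_of_lt (by norm_num) (by norm_num))
    · exact h
  have hs : (η + η⁻¹) ^ 2 = (algebraMap E (AlgebraicClosure E) x) ^ 2 := by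
    rw [← map_pow, hx]
    field_simp
    simp only [map_ofNat]
    linear_combination h4
  have hfix : σ (η + η⁻¹) = η + η⁻¹ := by
    rcases sq_eq_sq_iff_eq_or_eq_neg.1 hs with h | h <;> simp [h]
  rw [map_add, map_inv₀, hση] at hfix
  have h8 : (c : ℤ) % 8 = 1 ∨ (c : ℤ) % 8 = 7 := by
    rcases aux_sym η (η ^ c) hη0 (pow_ne_zero _ hη0) hfix.symm with h | h
    · left
      have := (aux_mod η 8 hη c 1).1 (by simpa using h)
      omega
    · right
      have := (aux_mod η 8 hη (c + 1) 0).1 (by simpa [pow_succ] using h)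
      omega
  have hodd : Odd c := by rw [Nat.odd_iff]; omega
  have h16 : (2 : ℤ) ^ 4 ∣ (c : ℤ) ^ 2 - 1 := by
    rcases h8 with h | h
    · obtain ⟨q, hq⟩ : ∃ q : ℤ, (c : ℤ) = 8 * q + 1 := ⟨c / 8, by omega⟩
      exact ⟨4 * q ^ 2 + q, by rw [hq]; ring⟩
    · obtain ⟨q, hq⟩ : ∃ q : ℤ, (c : ℤ) = 8 * q - 1 := ⟨c / 8 + 1, by omega⟩
      exact ⟨4 * q ^ 2 - q, by rw [hq]; ring⟩
  have hd := (aux_lte c k 4 hodd hk).2 h16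
  have : (σ ^ (2 * k)) ξ = ξ := by
    rw [aux_pow σ ξ c hc.symm]
    have := (aux_mod ξ _ hξ (c ^ (2 * k)) 1).2 (by push_cast; exact hd)
    simpa using this
  rw [← hi, map_pow, this]

theorem aux_upper {E : Type*} [Field E] [CharZero E]
    (k : ℕ) (hk : 1 ≤ k) (a : ℕ) (ha : 5 + padicValNat 2 k ≤ a)
    (H : ∀ σ : AlgebraicClosure E ≃ₐ[E] AlgebraicClosure E,
      ∀ ζ : AlgebraicClosure E, ζ ^ 2 ^ a = 1 → (σ ^ (2 * k)) ζ = ζ) :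
    ∃ y : E, (y ^ 2 - 2) ^ 2 = 2 := by
  obtain ⟨ξ, hξ⟩ := HasEnoughRootsOfUnity.exists_primitiveRoot (AlgebraicClosure E) (2 ^ a)
  have hξ0 : ξ ≠ 0 := hξ.ne_zero (by positivity)
  have hη : IsPrimitiveRoot (ξ ^ 2 ^ (a - 4)) 16 := by
    refine hξ.pow (by positivity) ?_
    rw [show (16 : ℕ) = 2 ^ 4 by norm_num, ← pow_add]; congr 1; omega
  set η := ξ ^ 2 ^ (a - 4) with hηd
  have hη0 : η ≠ 0 := pow_ne_zero _ hξ0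
  have h8 : η ^ 8 = -1 := by
    have : (η ^ 8) ^ 2 = 1 := by rw [← pow_mul]; exact hη.pow_eq_one
    rcases (show _ ∨ _ from by simpa using this) with h | h
    · exact absurd h (hη.pow_ne_one_of_pos_of_lt (by norm_num) (by norm_num))
    · exact h
  have hmem : (η + η⁻¹) ∈ Set.range (algebraMap E (AlgebraicClosure E)) := by
    rw [InfiniteGalois.mem_range_algebraMap_iff_fixed]
    intro σ
    obtain ⟨c, -, hc⟩ := hξ.eq_pow_of_pow_eq_one (ξ := σ ξ)
      (by rw [← map_pow, hξ.pow_eq_one, map_one])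
    have hση : σ η = η ^ c := by
      rw [hηd, map_pow, ← hc, ← pow_mul, ← pow_mul, mul_comm]
    have h1 := H σ ξ hξ.pow_eq_one
    rw [aux_pow σ ξ c hc.symm] at h1
    have h2 := (aux_mod ξ _ hξ (c ^ (2 * k)) 1).1 (by simpa using h1)
    push_cast at h2
    have h3 := (pow_dvd_pow (2 : ℤ) ha).trans h2
    have hodd : Odd c := by
      by_contra hne
      rw [Nat.not_odd_iff_even] at hne
      have e1 : (2 : ℤ) ∣ (c : ℤ) ^ (2 * k) :=
        dvd_pow (by exact_mod_cast hne.two_dvd) (by omega)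
      have e2 : (2 : ℤ) ∣ (c : ℤ) ^ (2 * k) - 1 := (dvd_pow_self 2 (by omega)).trans h3
      omega
    have h32 := (aux_lte c k 5 hodd hk).1 h3
    have h16 : (c : ℤ) % 16 = 1 ∨ (c : ℤ) % 16 = 15 := by
      obtain ⟨q, r, hq, hr0, hr⟩ : ∃ q r : ℤ, (c : ℤ) = 16 * q + r ∧ 0 ≤ r ∧ r < 16 :=
        ⟨c / 16, c % 16, by omega, by omega, by omega⟩
      have e : (32 : ℤ) ∣ r ^ 2 - 1 := by
        have : (c : ℤ) ^ 2 - 1 = 32 * (8 * q ^ 2 + q * r) + (r ^ 2 - 1) := by rw [hq]; ring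
        rw [this] at h32
        norm_num at h32
        exact h32
      interval_cases r <;> omega
    rw [map_add, map_inv₀, hση]
    rcases h16 with h | h
    · have := (aux_mod η 16 hη c 1).2 (by push_cast; omega)
      rw [this, pow_one]
    · have := (aux_mod η 16 hη (c + 1) 0).2 (by push_cast; omega)
      rw [pow_succ, pow_zero] at this
      rw [eq_inv_of_mul_eq_one_left this, inv_inv, add_comm]
  obtain ⟨y, hy⟩ := hmem
  refine ⟨y, (algebraMap E (AlgebraicClosure E)).injective ?_⟩
  simp only [map_pow, map_sub, map_ofNat, hy]
  field_simp
  linear_combination h8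

theorem aux_noy {n : ℕ} {E : Type*} [Field E] [NumberField E] [IsGalois ℚ E]
    (giso : (E ≃ₐ[ℚ] E) ≃* Multiplicative (Fin n → ZMod 2)) (y : E)
    (hy : (y ^ 2 - 2) ^ 2 = 2) : False := by
  set s := y ^ 2 - 2 with hs
  have hnot : s ∉ Set.range (algebraMap ℚ E) := by
    rintro ⟨q, hq⟩
    have : q ^ 2 = 2 := by
      apply (algebraMap ℚ E).injective
      rw [map_pow, hq, hy, map_ofNat]
    have hi := irrational_sqrt_two
    apply hi
    refine ⟨|q|, ?_⟩
    have h2 : ((q : ℝ)) ^ 2 = 2 := by exact_mod_cast this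
    rw [← h2, Real.sqrt_sq_eq_abs]; push_cast; rfl
  rw [IsGalois.mem_range_algebraMap_iff_fixed] at hnot
  push Not at hnot
  obtain ⟨τ, hτ⟩ := hnot
  have hτ2 : τ (τ y) = y := by
    have : τ * τ = 1 := by
      apply giso.injective
      rw [map_mul, map_one]
      apply Multiplicative.toAdd.injective
      rw [toAdd_mul, toAdd_one]
      funext i
      exact CharTwo.add_self_eq_zero _
    rw [← AlgEquiv.mul_apply, this, AlgEquiv.one_apply]
  have hτs : τ s = -s := by
    have : (τ s) ^ 2 = s ^ 2 := by rw [← map_pow, hy, map_ofNat]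
    exact (sq_eq_sq_iff_eq_or_eq_neg.1 this).resolve_left hτ
  have e1 : (τ y) ^ 2 = 2 - s := by
    have : τ s = (τ y) ^ 2 - 2 := by rw [hs, map_sub, map_pow, map_ofNat]
    linear_combination hτs - this
  have e2 : (y * τ y) ^ 2 = s ^ 2 := by
    rw [mul_pow, e1]; linear_combination (-s + 2) * hs - 2 * hy
  have e3 : τ (y * τ y) = y * τ y := by rw [map_mul, hτ2, mul_comm]
  have hs0 : s ≠ 0 := by rintro h; rw [h] at hy; norm_num at hy
  have e4 : s = -s := by
    rcases sq_eq_sq_iff_eq_or_eq_neg.1 e2 with h | h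
    · rw [h, hτs] at e3; exact e3.symm
    · rw [h, map_neg, hτs] at e3; linear_combination e3
  exact hs0 (self_eq_neg.1 e4)

theorem wl_two_of_two_elementary_with_sqrt_two
    (n : ℕ) (hn : 1 ≤ n)
    (E : Type*) [Field E] [NumberField E] (hreal : IsTotallyReal E)
    [IsGalois ℚ E]
    (giso : (E ≃ₐ[ℚ] E) ≃* Multiplicative (Fin n → ZMod 2))
    (hsqrt2 : ∃ x : E, x ^ 2 = 2)
    (k : ℕ) (hk : 1 ≤ k) :
    wl E (2 * k) 2 = 2 ^ (3 + padicValNat 2 (2 * k)) ∧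
    (2 : ℕ) ^ (3 + padicValNat 2 (2 * k)) = 2 ^ (4 + padicValNat 2 k) := by
  have hv : padicValNat 2 (2 * k) = 1 + padicValNat 2 k := by
    rw [padicValNat.mul (by norm_num) (by omega), padicValNat.self (by norm_num)]
  have e : 3 + padicValNat 2 (2 * k) = 4 + padicValNat 2 k := by omega
  refine ⟨?_, by rw [e]⟩
  rw [e, wl]
  congr 1
  apply IsGreatest.csSup_eq
  refine ⟨fun σ ζ hζ => aux_lower hsqrt2 k hk σ ζ hζ, fun a ha => ?_⟩
  by_contra hlt
  obtain ⟨y, hy⟩ := aux_upper k hk a (by omega) ha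
  exact aux_noy giso y hy
end
end

section
/- Let p be a prime and n ≥ 2 an integer. Let E be a totally real Galois extension of ℚ with Gal(E/ℚ) ≅ (ℤ/pℤ)^{⊕n}, and let K_1, …, K_t, with t = (p^n − 1)/(p − 1), be the distinct subfields of E of degree p over ℚ. Then for every complex number s ≠ 1 one has ζ(s)^{(p^n − p)/(p − 1)} · ζ_E(s) = ∏_{j=1}^{t} ζ_{K_j}(s). -/
open scoped Classical
noncomputable section

open Module

/-- `Z` is the Dedekind zeta function of `F`: it is holomorphic away from `1` and agrees with
the Dirichlet series `∑ N(𝔞)^{-s}` over nonzero integral ideals on the half-plane `Re s > 1`. -/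
def IsDedekindZeta (F : Type*) [Field F] (Z : ℂ → ℂ) : Prop :=
  (∀ s : ℂ, s ≠ 1 → DifferentiableAt ℂ Z s) ∧
  ∀ s : ℂ, 1 < s.re → Z s =
    ∑' I : {I : Ideal (NumberField.RingOfIntegers F) // I ≠ ⊥},
      (Nat.card (NumberField.RingOfIntegers F ⧸ (I : Ideal (NumberField.RingOfIntegers F))) : ℂ)
        ^ (-s)


section A
open IsDedekindDomain Filter Topology

variable {R : Type*} [CommRing R] [IsDedekindDomain R]

def goodS (s : Finset (HeightOneSpectrum R)) : Set {I : Ideal R // I ≠ ⊥} :=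
  {I | ∀ v : HeightOneSpectrum R, v.asIdeal ∣ I.1 → v ∈ s}

def mulV (v : HeightOneSpectrum R) (I : {I : Ideal R // I ≠ ⊥}) : {I : Ideal R // I ≠ ⊥} :=
  ⟨v.asIdeal * I.1, mul_ne_zero v.ne_bot I.2⟩

lemma mulV_inj (v : HeightOneSpectrum R) : Function.Injective (mulV v) := by
  intro I J h
  have h' := congrArg Subtype.val h
  exact Subtype.ext (mul_left_cancel₀ v.ne_bot h')

lemma range_mulV (v : HeightOneSpectrum R) : Set.range (mulV v) = {I | v.asIdeal ∣ I.1} := by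
  ext I
  constructor
  · rintro ⟨J, rfl⟩
    exact Dvd.intro _ rfl
  · rintro ⟨J, hJ⟩
    refine ⟨⟨J, ?_⟩, Subtype.ext hJ.symm⟩
    rintro rfl
    exact I.2 (by rw [hJ]; simp)

lemma euler_finite (f : Ideal R →* ℂ) (hf : Summable fun I : {I : Ideal R // I ≠ ⊥} => f I.1)
    (s : Finset (HeightOneSpectrum R)) :
    (∑' I, (goodS s).indicator (fun I => f I.1) I) * ∏ v ∈ s, (1 - f v.asIdeal) = 1 := by
  induction s using Finset.induction_on with
  | empty =>
    have : goodS (∅ : Finset (HeightOneSpectrum R)) = {⟨⊤, fun h => top_ne_bot h⟩} := by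
      ext I
      simp only [goodS, Finset.notMem_empty, imp_false, Set.mem_ofPred_eq, Set.mem_singleton_iff]
      constructor
      · intro h
        by_contra hI
        obtain ⟨M, hM, hle⟩ := Ideal.exists_le_maximal I.1 (fun h => hI (Subtype.ext h))
        exact h ⟨M, hM.isPrime, fun h => I.2 (by rw [h] at hle; exact le_bot_iff.1 hle)⟩
          (Ideal.dvd_iff_le.2 hle)
      · rintro rfl v hv
        exact v.isPrime.ne_top (top_le_iff.1 (Ideal.dvd_iff_le.1 hv))
    rw [this, ← tsum_subtype]
    simp [← Ideal.one_eq_top]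
  | insert v s hv ih =>
    rw [Finset.prod_insert hv, ← mul_assoc]
    convert ih using 2
    have h1 : ∀ I, (goodS (insert v s)).indicator (fun I => f I.1) I =
        (goodS s).indicator (fun I => f I.1) I +
        (Set.range (mulV v)).indicator ((goodS (insert v s)).indicator (fun I => f I.1)) I := by
      intro I
      by_cases hI : v.asIdeal ∣ I.1
      · have a : I ∈ Set.range (mulV v) := by rw [range_mulV]; exact hI
        have b : I ∉ goodS s := fun h => hv (h v hI)
        simp [a, b]
      · have a : I ∉ Set.range (mulV v) := by rw [range_mulV]; exact hI
        have b : I ∈ goodS s ↔ I ∈ goodS (insert v s) := by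
          constructor
          · intro h w hw
            exact Finset.mem_insert_of_mem (h w hw)
          · intro h w hw
            rcases Finset.mem_insert.1 (h w hw) with rfl | h
            · exact absurd hw hI
            · exact h
        by_cases c : I ∈ goodS s
        · have c' := b.1 c
          simp [a, c, c']
        · have c' : I ∉ goodS (insert v s) := fun h => c (b.2 h)
          simp [a, c, c']
    have h2 : ∑' I, (Set.range (mulV v)).indicator ((goodS (insert v s)).indicator (fun I => f I.1)) I
        = f v.asIdeal * ∑' I, (goodS (insert v s)).indicator (fun I => f I.1) I := by
      rw [← tsum_subtype, tsum_range _ (mulV_inj v), ← tsum_mul_left]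
      congr 1
      ext I
      have : mulV v I ∈ goodS (insert v s) ↔ I ∈ goodS (insert v s) := by
        constructor
        · intro h w hw
          exact h w (Dvd.dvd.mul_left hw _)
        · intro h w hw
          rcases w.prime.dvd_or_dvd hw with hw | hw
          · have : w = v := by
              ext1
              exact (v.isMaximal.eq_of_le w.isPrime.ne_top (Ideal.dvd_iff_le.1 hw)).symm
            rw [this]; exact Finset.mem_insert_self _ _
          · exact h w hw
      by_cases c : I ∈ goodS (insert v s)
      · rw [Set.indicator_of_mem c, Set.indicator_of_mem (this.2 c)]
        simp [mulV]
      · rw [Set.indicator_of_notMem c, Set.indicator_of_notMem (fun h => c (this.1 h))]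
        simp
    have h3 := tsum_congr (L := .unconditional _) h1
    rw [(hf.indicator _).tsum_add ((hf.indicator _).indicator _), h2] at h3
    linear_combination h3

lemma euler_hasProd (f : Ideal R →* ℂ) (hf : Summable fun I : {I : Ideal R // I ≠ ⊥} => f I.1) :
    HasProd (fun v : HeightOneSpectrum R => (1 - f v.asIdeal)⁻¹)
      (∑' I : {I : Ideal R // I ≠ ⊥}, f I.1) := by
  rw [HasProd]
  have : ∀ s : Finset (HeightOneSpectrum R), ∏ v ∈ s, (1 - f v.asIdeal)⁻¹ =
      ∑' I, (goodS s).indicator (fun I => f I.1) I := by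
    intro s
    rw [Finset.prod_inv_distrib]
    exact (eq_inv_of_mul_eq_one_left (euler_finite f hf s)).symm
  simp_rw [this]
  refine tendsto_tsum_of_dominated_convergence (bound := fun I => ‖f I.1‖) hf.norm ?_ ?_
  · intro I
    have hfin : {v : HeightOneSpectrum R | v.asIdeal ∣ I.1}.Finite := Ideal.finite_factors I.2
    refine tendsto_const_nhds.congr' ?_
    simp only [SummationFilter.unconditional_filter]
    filter_upwards [eventually_ge_atTop hfin.toFinset] with s hs
    rw [Set.indicator_of_mem]
    intro v hv
    exact hs (by simpa using hv)
  · exact Eventually.of_forall fun s I => norm_indicator_le_norm_self _ _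
end A
section B
open IsDedekindDomain Filter Topology NumberField Ideal Asymptotics

variable (F : Type*) [Field F] [NumberField F]



lemma summable_norm (s : ℂ) (hs : 1 < s.re) :
    Summable fun I : {I : Ideal (𝓞 F) // I ≠ ⊥} => ((absNorm I.1 : ℕ) : ℂ) ^ (-s) := by
  have h : LSeriesSummable (fun n ↦ ((Nat.card {I : Ideal (𝓞 F) // absNorm I = n} : ℝ) : ℂ)) s := by
    refine LSeriesSummable_of_sum_norm_bigO_and_nonneg (r := 1) ?_ (fun _ => by positivity)
      zero_le_one hs
    refine isBigO_atTop_natCast_rpow_of_tendsto_div_rpow (𝕜 := ℝ) (a := dedekindZeta_residue F) ?_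
    simp only [Real.rpow_one]
    refine ((Ideal.tendsto_norm_le_div_atTop₀ F).comp tendsto_natCast_atTop_atTop).congr fun n ↦ ?_
    simp only [Function.comp_apply, Nat.cast_le, ← Nat.cast_sum]
    congr
    rw [← add_left_inj 1, ← card_norm_le_eq_card_norm_le_add_one,
      show Finset.Icc 1 n = Finset.Ioc 0 n from Finset.Icc_succ_left_eq_Ioc _ _,
      show 1 = Nat.card {I : Ideal (𝓞 F) // absNorm I = 0} by simp [Ideal.absNorm_eq_zero_iff],
      Finset.sum_Ioc_add_eq_sum_Icc (n.zero_le),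
      ← Finset.card_preimage_eq_sum_card_image_eq (fun k _ ↦ finite_setOfPred_absNorm_eq k)]
    simp [Set.coe_eq_subtype]
  refine Summable.of_norm ?_
  have key : Summable fun I : Ideal (𝓞 F) => ‖((absNorm I : ℕ) : ℂ) ^ (-s)‖ := by
    rw [← (Equiv.sigmaFiberEquiv (fun I : Ideal (𝓞 F) => absNorm I)).summable_iff]
    rw [summable_sigma_of_nonneg (fun _ => by exact norm_nonneg _)]
    have hfin : ∀ n : ℕ, Finite {I : Ideal (𝓞 F) // absNorm I = n} := fun n =>
      finite_setOfPred_absNorm_eq n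
    constructor
    · intro n
      have := hfin n
      exact Summable.of_finite
    · refine h.norm.congr fun n => ?_
      have := hfin n
      have e : ∀ I : {I : Ideal (𝓞 F) // absNorm I = n},
        ((fun I : Ideal (𝓞 F) => ‖((absNorm I : ℕ) : ℂ) ^ (-s)‖) ∘ 
          (Equiv.sigmaFiberEquiv (fun I : Ideal (𝓞 F) => absNorm I))) ⟨n, I⟩ = ‖(n : ℂ) ^ (-s)‖ := by
        intro I
        simp [I.2]
      rw [tsum_congr e, tsum_const, LSeries.norm_term_eq]
      have hs0 : s ≠ 0 := by rintro rfl; simp at hs; linarith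
      split_ifs with h0
      · subst h0
        simp [hs0]
      · rw [Complex.norm_natCast_cpow_of_pos (Nat.pos_of_ne_zero h0)]
        simp [Real.rpow_neg, div_eq_mul_inv]
  exact key.comp_injective Subtype.val_injective

def idNormHom (s : ℂ) : Ideal (𝓞 F) →* ℂ where
  toFun I := ((absNorm I : ℕ) : ℂ) ^ (-s)
  map_one' := by simp
  map_mul' I J := by
    rw [map_mul, Nat.cast_mul, Complex.natCast_mul_natCast_cpow]

def overEquiv : HeightOneSpectrum (𝓞 F) ≃
    Σ q : Nat.Primes, (span {((q : ℕ) : ℤ)}).primesOver (𝓞 F) where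
  toFun v := ⟨⟨absNorm (under ℤ v.asIdeal), by
      have : NeZero v.asIdeal := ⟨v.ne_bot⟩
      exact Nat.absNorm_under_prime _⟩, ⟨v.asIdeal, v.isPrime, by
      exact Int.liesOver_span_absNorm _⟩⟩
  invFun x := ⟨x.2.1, x.2.2.1, by
    have := x.2.2.2
    have := x.1.2
    refine Ideal.ne_bot_of_liesOver_of_ne_bot (p := span {((x.1 : ℕ) : ℤ)}) ?_ x.2.1
    simpa using this.ne_zero⟩
  left_inv v := by rfl
  right_inv := by
    rintro ⟨q, P, h1, h2⟩
    have hq : absNorm (under ℤ P) = q := by simp [← h2.over]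
    obtain ⟨q, hq'⟩ := q
    dsimp only at hq
    subst hq
    rfl

lemma zeta_hasProd [IsGalois ℚ F] (s : ℂ) (hs : 1 < s.re) :
    HasProd (fun q : Nat.Primes =>
      ((1 - (((q : ℕ) : ℂ) ^ (-s)) ^ ((span {((q : ℕ) : ℤ)}).inertiaDegIn (𝓞 F)))⁻¹) ^
        ((span {((q : ℕ) : ℤ)}).primesOver (𝓞 F)).ncard)
    (∑' I : {I : Ideal (𝓞 F) // I ≠ ⊥}, (Nat.card ((𝓞 F) ⧸ I.1) : ℂ) ^ (-s)) := by
  have h := euler_hasProd (idNormHom F s) (summable_norm F s hs)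
  rw [← (overEquiv F).symm.hasProd_iff] at h
  refine h.sigma fun q => ?_
  have : Fact (q : ℕ).Prime := ⟨q.2⟩
  have : Finite ((span {((q : ℕ) : ℤ)}).primesOver (𝓞 F)) := 
    Algebra.QuasiFinite.finite_primesOver _
  have := Fintype.ofFinite ((span {((q : ℕ) : ℤ)}).primesOver (𝓞 F))
  have hfin := hasProd_fintype (fun c : (span {((q : ℕ) : ℤ)}).primesOver (𝓞 F) =>
    ((fun v : HeightOneSpectrum (𝓞 F) => (1 - (idNormHom F s) v.asIdeal)⁻¹) ∘
      (overEquiv F).symm) ⟨q, c⟩) (SummationFilter.unconditional _)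
  convert hfin using 1
  rw [Finset.prod_congr rfl (g := fun _ => (1 - (((q : ℕ) : ℂ) ^ (-s)) ^ 
    ((span {((q : ℕ) : ℤ)}).inertiaDegIn (𝓞 F)))⁻¹)]
  · rw [Finset.prod_const, Finset.card_univ, Set.fintypeCard_eq_ncard]
  · rintro ⟨P, h1, h2⟩ -
    simp only [idNormHom, overEquiv, Function.comp_apply, Equiv.coe_fn_symm_mk, MonoidHom.coe_mk,
      OneHom.coe_mk]
    rw [inertiaDegIn_eq_inertiaDeg _ P Gal(F/ℚ), ← pow_inertiaDeg (q : ℕ) P]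
    congr 2
    rw [Nat.cast_pow, ← Complex.natCast_cpow_natCast_mul, mul_comm, 
      Complex.cpow_mul_nat]
end B
section C
open LinearAlgebra.Projectivization

lemma count_hyper (p : ℕ) [Fact p.Prime] (V : Type*) [AddCommGroup V] [Module (ZMod p) V]
    [Finite V] (W : Submodule (ZMod p) V) :
    (p - 1) * Nat.card {H : Submodule (ZMod p) V // Nat.card (V ⧸ H) = p ∧ W ≤ H} + 1
      = Nat.card (V ⧸ W) := by
  have hcard : ∀ (U : Type _) [AddCommGroup U] [Module (ZMod p) U] [Finite U],
      Nat.card U = p ^ finrank (ZMod p) U := by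
    intro U _ _ _
    rw [Module.natCard_eq_pow_finrank (K := ZMod p), Nat.card_zmod]
  have hVW : Finite (V ⧸ W) := Finite.of_surjective W.mkQ W.mkQ_surjective
  have hp := (Fact.out : p.Prime)
  let e1 : ℙ (ZMod p) (Dual (ZMod p) (V ⧸ W)) ≃ 
     {L : Submodule (ZMod p) (Dual (ZMod p) (V ⧸ W)) // finrank (ZMod p) L = 1} := 
     Projectivization.equivSubmodule _ _
  let e2 : {H : Submodule (ZMod p) V // Nat.card (V ⧸ H) = p ∧ W ≤ H} ≃
     {L : Submodule (ZMod p) (V ⧸ W) // finrank (ZMod p) ((V ⧸ W) ⧸ L) = 1} := by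
    refine Equiv.trans (Equiv.trans (Equiv.subtypeEquivRight ?_) 
      (Equiv.subtypeSubtypeEquivSubtypeInter (fun H => W ≤ H) (fun H => Nat.card (V ⧸ H) = p)).symm) ?_
    · intro H; exact and_comm
    refine (Equiv.subtypeEquiv (Submodule.comapMkQRelIso W).toEquiv ?_).symm
    intro L
    have hh : Nat.card (V ⧸ ((Submodule.comapMkQRelIso W).toEquiv L).1) = Nat.card ((V ⧸ W) ⧸ L) := by
      exact AddSubgroup.index_comap_of_surjective (f := W.mkQ.toAddMonoidHom) L.toAddSubgroup
        W.mkQ_surjective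
    have : Finite ((V ⧸ W) ⧸ L) := Finite.of_surjective L.mkQ L.mkQ_surjective
    refine Iff.trans ?_ (Eq.congr_left hh.symm)
    rw [hcard ((V ⧸ W) ⧸ L)]
    constructor
    · intro h; rw [h, pow_one]
    · intro h; exact Nat.pow_right_injective hp.two_le (by simpa using h)
  let e3 : {L : Submodule (ZMod p) (V ⧸ W) // finrank (ZMod p) ((V ⧸ W) ⧸ L) = 1} ≃
     {L : Submodule (ZMod p) (Dual (ZMod p) (V ⧸ W)) // finrank (ZMod p) L = 1} := by
    refine Equiv.subtypeEquiv ((Subspace.orderIsoFiniteDimensional (K := ZMod p) (V := V ⧸ W)).toEquiv.trans OrderDual.ofDual) ?_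
    intro L
    have := (Submodule.dualQuotEquivDualAnnihilator L).finrank_eq
    rw [Subspace.dual_finrank_eq] at this
    rw [this]
    rfl
  rw [Nat.card_congr (e2.trans (e3.trans e1.symm))]
  have : Finite (Dual (ZMod p) (V ⧸ W)) := Module.finite_of_finite (ZMod p)
  have := Projectivization.card' (ZMod p) (Dual (ZMod p) (V ⧸ W))
  rw [Nat.card_zmod] at this
  rw [mul_comm, ← this, hcard, hcard (V ⧸ W), Subspace.dual_finrank_eq]

lemma count_sub (p n : ℕ) [Fact p.Prime] (G : Type*) [Group G]
    (giso : G ≃* Multiplicative (Fin n → ZMod p)) (D : Subgroup G) :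
    (p - 1) * Nat.card {H : Subgroup G // H.index = p ∧ D ≤ H} + 1 = D.index := by
  let V := Fin n → ZMod p
  let e : Subgroup G ≃o Submodule (ZMod p) V :=
    (giso.mapSubgroup.trans Subgroup.toAddSubgroup').trans (AddSubgroup.toZModSubmodule p)
  have he : ∀ H : Subgroup G, Nat.card (V ⧸ e H) = H.index := by
    intro H
    have : (H.map giso.toMonoidHom).index = H.index :=
      Subgroup.index_map_of_bijective giso.bijective H
    rw [← this]
    rfl
  have := count_hyper p V (e D)
  rw [he] at this
  rw [← this]
  congr 2
  refine Nat.card_congr (Equiv.subtypeEquiv e.toEquiv ?_)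
  intro H
  have h1 : e.toEquiv H = e H := rfl
  rw [h1, he, e.le_iff_le]
end C
section D
open NumberField Ideal Pointwise

variable {E : Type*} [Field E] [NumberField E] [IsGalois ℚ E]

lemma local_sub (K : IntermediateField ℚ E) [IsGalois ℚ K] (q : ℕ) [Fact q.Prime]
    (P : Ideal (𝓞 E)) [P.IsPrime] [P.LiesOver (span {(q : ℤ)})] :
    (span {(q : ℤ)}).ramificationIdxIn (𝓞 K) *
      Nat.card ((P.inertia Gal(E/ℚ)).subgroupOf K.fixingSubgroup) = Nat.card (P.inertia Gal(E/ℚ)) ∧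
    ((span {(q : ℤ)}).ramificationIdxIn (𝓞 K) * (span {(q : ℤ)}).inertiaDegIn (𝓞 K)) *
      Nat.card ((MulAction.stabilizer Gal(E/ℚ) P).subgroupOf K.fixingSubgroup) =
        Nat.card (MulAction.stabilizer Gal(E/ℚ) P) := by
  have hq := (Fact.out : q.Prime)
  have hq0 : (span {(q : ℤ)}) ≠ ⊥ := by simpa using hq.ne_zero
  let PK := P.under (𝓞 K)
  have i1 : PK.LiesOver (span {(q : ℤ)}) := inferInstance
  have i0 : PK.IsPrime := inferInstance
  have hPK : PK ≠ ⊥ := Ideal.ne_bot_of_liesOver_of_ne_bot hq0 PK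
  have i2 : IsGaloisGroup K.fixingSubgroup K E := 
    inferInstanceAs (IsGaloisGroup (fixingSubgroup Gal(E/ℚ) (K : Set E)) K E)
  have i3 : IsGaloisGroup K.fixingSubgroup (𝓞 K) (𝓞 E) := .of_isFractionRing _ _ _ K E
  have i4 : PK.IsMaximal := i0.isMaximal hPK
  have i5 : Finite (𝓞 K ⧸ PK) := Ring.HasFiniteQuotients.finiteQuotient hPK
  have i6 : Finite (ℤ ⧸ span {(q : ℤ)}) := Ring.HasFiniteQuotients.finiteQuotient hq0
  have a1 := card_inertia_eq_ramificationIdxIn (G := Gal(E/ℚ)) (span {(q : ℤ)}) P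
  have a2 := card_inertia_eq_ramificationIdxIn (G := K.fixingSubgroup) PK P
  have b1 := card_stabilizer_eq (G := Gal(E/ℚ)) (span {(q : ℤ)}) P
  have b2 := card_stabilizer_eq (G := K.fixingSubgroup) PK P
  have c1 := ramificationIdxIn_mul_ramificationIdxIn (p := span {(q : ℤ)}) PK Gal(K/ℚ) (𝓞 E) 
    Gal(E/ℚ) K.fixingSubgroup
  have c2 := inertiaDegIn_mul_inertiaDegIn (span {(q : ℤ)}) PK Gal(K/ℚ) (𝓞 E) 
    Gal(E/ℚ) K.fixingSubgroup
  have d1 : (P.inertia Gal(E/ℚ)).subgroupOf K.fixingSubgroup = P.inertia K.fixingSubgroup := by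
    ext x
    exact Ideal.coe_mem_inertia
  have d2 : Nat.card ((MulAction.stabilizer Gal(E/ℚ) P).subgroupOf K.fixingSubgroup) =
      PK.ramificationIdxIn (𝓞 E) * PK.inertiaDegIn (𝓞 E) := by
    rw [← b2]
    exact Nat.card_congr (Equiv.subtypeEquivRight fun x => Iff.rfl)
  rw [d1, d2, a1, a2, b1, ← c1, ← c2]
  exact ⟨rfl, by ring⟩

lemma inertia_le (q p : ℕ) [Fact q.Prime] 
    (P : Ideal (𝓞 E)) [P.IsPrime] [P.LiesOver (span {(q : ℤ)})] 
    (hG : ∀ σ : Gal(E/ℚ), σ ^ p = 1) (hp : 0 < p) : P.inertiaDeg ℤ ≤ p := by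
  have hq := (Fact.out : q.Prime)
  have hq0 : (span {(q : ℤ)}) ≠ ⊥ := by simpa using hq.ne_zero
  have hP : P ≠ ⊥ := Ideal.ne_bot_of_liesOver_of_ne_bot hq0 P
  have i4 : P.IsMaximal := IsPrime.isMaximal inferInstance hP
  have i5 : Finite (𝓞 E ⧸ P) := Ring.HasFiniteQuotients.finiteQuotient hP
  obtain ⟨σ, hσ⟩ := IsArithFrobAt.exists_of_isInvariant ℤ Gal(E/ℚ) P
  have hcard : Nat.card (ℤ ⧸ P.under ℤ) = q := by
    rw [← over_def P (span {(q : ℤ)}), Int.card_ideal_quot]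
  have h1 : ∀ (k : ℕ) (x : 𝓞 E), Ideal.Quotient.mk P ((σ ^ k) • x) = (Ideal.Quotient.mk P x) ^ (q ^ k) := by
    intro k
    induction k with
    | zero => intro x; simp
    | succ k ih =>
      intro x
      rw [pow_succ, mul_smul, ih]
      have := hσ.mk_apply x
      rw [hcard] at this
      have h' : Ideal.Quotient.mk P (σ • x) = (Ideal.Quotient.mk P x) ^ q := this
      rw [h', ← pow_mul, pow_succ, mul_comm q]
  let _ : Field (𝓞 E ⧸ P) := Ideal.Quotient.field P
  have h2 : ∀ y : 𝓞 E ⧸ P, y ^ (q ^ p) = y := by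
    intro y
    obtain ⟨x, rfl⟩ := Ideal.Quotient.mk_surjective y
    rw [← h1 p x, hG, one_smul]
  obtain ⟨u, hu⟩ := IsCyclic.exists_ofOrder_eq_natCard (α := (𝓞 E ⧸ P)ˣ)
  have h3 : u ^ (q ^ p - 1) = 1 := by
    have : u ^ (q ^ p - 1) * u = u := by
      rw [← pow_succ, Nat.sub_add_cancel (Nat.pos_of_ne_zero (pow_ne_zero _ hq.ne_zero))]
      ext
      simpa using h2 u
    simpa using this
  have h4 := orderOf_dvd_of_pow_eq_one h3
  have h5 : 1 < q ^ p := Nat.one_lt_pow hp.ne' hq.one_lt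
  have h6 := Nat.le_of_dvd (by omega) h4
  rw [hu, Nat.card_units] at h6
  have h7 : Nat.card (𝓞 E ⧸ P) = q ^ P.inertiaDeg ℤ := by
    rw [pow_inertiaDeg q P]; rfl
  rw [h7] at h6
  have h8 : q ^ P.inertiaDeg ℤ ≤ q ^ p := by omega
  exact (Nat.pow_le_pow_iff_right hq.one_lt).1 h8

lemma card_sub_iff {G : Type*} [Group G] [Finite G] (A H : Subgroup G) :
    Nat.card (A.subgroupOf H) = Nat.card A ↔ A ≤ H := by
  have h : Nat.card (A.subgroupOf H) = Nat.card (A ⊓ H : Subgroup G) := by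
    rw [← Subgroup.subgroupOf_map_subtype, Subgroup.card_map_of_injective H.subtype_injective]
  rw [h]
  constructor
  · intro h1
    have := Subgroup.eq_of_le_of_card_ge (inf_le_left : A ⊓ H ≤ A) h1.ge
    exact inf_eq_left.1 this
  · intro h1
    rw [inf_eq_left.2 h1]

lemma local_type (K : IntermediateField ℚ E) [IsGalois ℚ K] (q p : ℕ) [Fact q.Prime]
    (hp : p.Prime) (hK : finrank ℚ K = p)
    (P : Ideal (𝓞 E)) [P.IsPrime] [P.LiesOver (span {(q : ℤ)})] :
    (MulAction.stabilizer Gal(E/ℚ) P ≤ K.fixingSubgroup →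
      (span {(q : ℤ)}).inertiaDegIn (𝓞 K) = 1 ∧ ((span {(q : ℤ)}).primesOver (𝓞 K)).ncard = p) ∧
    (P.inertia Gal(E/ℚ) ≤ K.fixingSubgroup → ¬ MulAction.stabilizer Gal(E/ℚ) P ≤ K.fixingSubgroup →
      (span {(q : ℤ)}).inertiaDegIn (𝓞 K) = p ∧ ((span {(q : ℤ)}).primesOver (𝓞 K)).ncard = 1) ∧
    (¬ P.inertia Gal(E/ℚ) ≤ K.fixingSubgroup →
      (span {(q : ℤ)}).inertiaDegIn (𝓞 K) = 1 ∧ ((span {(q : ℤ)}).primesOver (𝓞 K)).ncard = 1) := by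
  have hq := (Fact.out : q.Prime)
  have hq0 : (span {(q : ℤ)}) ≠ ⊥ := by simpa using hq.ne_zero
  have i7 : (span {(q : ℤ)}).IsMaximal := Int.ideal_span_isMaximal_of_prime q
  obtain ⟨h1, h2⟩ := local_sub K q P
  have h3 := ncard_primesOver_mul_ramificationIdxIn_mul_inertiaDegIn (span {(q : ℤ)}) (𝓞 K) Gal(K/ℚ)
  rw [IsGalois.card_aut_eq_finrank, hK] at h3
  rw [← card_sub_iff, ← card_sub_iff]
  have hI : 0 < Nat.card (P.inertia Gal(E/ℚ)) := Nat.card_pos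
  have hD : 0 < Nat.card (MulAction.stabilizer Gal(E/ℚ) P) := Nat.card_pos
  generalize (span {(q : ℤ)}).ramificationIdxIn (𝓞 K) = e at *
  generalize (span {(q : ℤ)}).inertiaDegIn (𝓞 K) = f at *
  generalize ((span {(q : ℤ)}).primesOver (𝓞 K)).ncard = g at *
  generalize Nat.card (P.inertia Gal(E/ℚ)) = cI at *
  generalize Nat.card (MulAction.stabilizer Gal(E/ℚ) P) = cD at *
  generalize Nat.card ((P.inertia Gal(E/ℚ)).subgroupOf K.fixingSubgroup) = cI1 at *
  generalize Nat.card ((MulAction.stabilizer Gal(E/ℚ) P).subgroupOf K.fixingSubgroup) = cD1 at *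
  have hp1 := hp.one_lt
  refine ⟨fun h => ?_, fun h h' => ?_, fun h => ?_⟩
  · subst h
    have : e * f = 1 := by nlinarith
    have hf := Nat.eq_one_of_mul_eq_one_left this
    rw [this] at h3
    exact ⟨hf, by omega⟩
  · subst h
    have he : e = 1 := by nlinarith
    subst he
    have hf : f ≠ 1 := by rintro rfl; simp at h2; exact h' h2
    have hf2 : f ∣ p := ⟨g, by rw [← h3]; ring⟩
    have hf3 := ((Nat.dvd_prime hp).1 hf2).resolve_left hf
    subst hf3
    exact ⟨rfl, by nlinarith⟩
  · have he : e ≠ 1 := by rintro rfl; simp at h1; exact h h1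
    have hf2 : e ∣ p := ⟨f * g, by rw [← h3]; ring⟩
    have hf3 := ((Nat.dvd_prime hp).1 hf2).resolve_left he
    subst hf3
    have : g * f = 1 := by
      have : e * (g * f) = e * 1 := by rw [mul_one]; nth_rw 2 [← h3]; ring
      exact Nat.eq_of_mul_eq_mul_left hp.pos this
    exact ⟨Nat.eq_one_of_mul_eq_one_left this, Nat.eq_one_of_mul_eq_one_right this⟩
end D
section E
lemma comb_id (t p g f : ℕ) (hp : p.Prime) (ht : 0 < t) (A B : Fin t → Prop) (hAB : ∀ i, A i → B i)
    (F G : Fin t → ℕ) (h1 : ∀ i, A i → F i = 1 ∧ G i = p)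
    (h2 : ∀ i, B i → ¬ A i → F i = p ∧ G i = 1)
    (h3 : ∀ i, ¬ B i → F i = 1 ∧ G i = 1)
    (hA : (p - 1) * Nat.card {i // A i} + 1 = g)
    (hB : (p - 1) * Nat.card {i // B i} + 1 = g * f) (hf : f = 1 ∨ f = p) (y : ℕ → ℂ) :
    y 1 ^ (t - 1) * y f ^ g = ∏ i, y (F i) ^ G i := by
  have e1 : ∀ i, y (F i) ^ G i =
      y 1 ^ (if A i then p else if B i then 0 else 1) * y p ^ (if B i ∧ ¬ A i then 1 else 0) := by
    intro i
    by_cases a : A i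
    · obtain ⟨u, v⟩ := h1 i a
      simp [a, u, v]
    · by_cases b : B i
      · obtain ⟨u, v⟩ := h2 i b a
        simp [a, b, u, v]
      · obtain ⟨u, v⟩ := h3 i b
        simp [a, b, u, v]
  rw [Finset.prod_congr rfl fun i _ => e1 i, Finset.prod_mul_distrib, Finset.prod_pow_eq_pow_sum,
    Finset.prod_pow_eq_pow_sum]
  have ca : ∀ C : Fin t → Prop, Nat.card {i // C i} = ∑ i, if C i then 1 else 0 := by
    intro C
    rw [Nat.card_eq_fintype_card, Fintype.card_subtype, Finset.card_filter]
  rw [ca] at hA hB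
  have s1 : (∑ i, if A i then p else if B i then 0 else 1) + (∑ i, if B i then 1 else 0) =
      t + p * ∑ i, if A i then 1 else 0 := by
    rw [Finset.mul_sum]
    have ht1 : t = ∑ _i : Fin t, 1 := by simp
    conv_rhs => enter [1]; rw [ht1]
    rw [← Finset.sum_add_distrib, ← Finset.sum_add_distrib]
    refine Finset.sum_congr rfl fun i _ => ?_
    have := hAB i
    by_cases a : A i
    · have := this a; simp [a, this]; ring
    · by_cases b : B i <;> simp [a, b]
  have s2 : (∑ i, if B i ∧ ¬ A i then 1 else 0) + (∑ i, if A i then 1 else 0) =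
      ∑ i, if B i then 1 else 0 := by
    rw [← Finset.sum_add_distrib]
    refine Finset.sum_congr rfl fun i _ => ?_
    have := hAB i
    by_cases a : A i
    · have := this a; simp [a, this]
    · by_cases b : B i <;> simp [a, b]
  generalize (∑ i, if A i then p else if B i then 0 else 1) = S1 at *
  generalize (∑ i, if B i ∧ ¬ A i then 1 else 0) = S2 at *
  generalize (∑ i, if A i then 1 else 0) = a at *
  generalize (∑ i, if B i then 1 else 0) = b at *
  obtain ⟨m, rfl⟩ : ∃ m, p = m + 1 := ⟨p - 1, by have := hp.pos; omega⟩
  have hm : 0 < m := by have := hp.one_lt; omega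
  simp only [Nat.add_sub_cancel] at *
  rcases hf with rfl | rfl
  · have hab : a = b := by
      have : m * a = m * b := by omega
      exact Nat.eq_of_mul_eq_mul_left hm this
    subst hab
    have : S2 = 0 := by omega
    subst this
    rw [← pow_add, pow_zero, mul_one]
    congr 1
    have : (m + 1) * a = m * a + a := by ring
    omega
  · have hab : b = (m + 1) * a + 1 := by
      have : m * b = m * ((m + 1) * a + 1) := by
        have : m * b + 1 = m * ((m + 1) * a + 1) + 1 := by rw [hB, ← hA]; ring
        omega
      exact Nat.eq_of_mul_eq_mul_left hm this
    have : (m + 1) * a = m * a + a := by ring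
    have q1 : S2 = g := by omega
    have q2 : S1 = t - 1 := by omega
    rw [q1, q2]

open NumberField Ideal Pointwise

variable {E : Type*} [Field E] [NumberField E] [IsGalois ℚ E]

lemma t_facts (p n : ℕ) (hp : p.Prime) (hn : 2 ≤ n) : 0 < (p ^ n - 1) / (p - 1) ∧
    (p ^ n - p) / (p - 1) = (p ^ n - 1) / (p - 1) - 1 := by
  obtain ⟨m, rfl⟩ : ∃ m, p = m + 1 := ⟨p - 1, by have := hp.pos; omega⟩
  have hm : 0 < m := by have := hp.one_lt; omega
  have h1 : m + 1 ≤ (m + 1) ^ n := Nat.le_self_pow (by omega) _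
  have h2 : (m + 1) ^ n - 1 = ((m + 1) ^ n - (m + 1)) + m := by omega
  simp only [Nat.add_sub_cancel]
  rw [h2, Nat.add_div_right _ hm]
  simp

lemma index_fix (K : IntermediateField ℚ E) : K.fixingSubgroup.index = finrank ℚ K := by
  have h1 := K.fixingSubgroup.card_mul_index
  rw [IsGalois.card_fixingSubgroup_eq_finrank, IsGalois.card_aut_eq_finrank,
    ← Module.finrank_mul_finrank ℚ K E, mul_comm] at h1
  exact Nat.eq_of_mul_eq_mul_right Module.finrank_pos h1

lemma local_main (p n : ℕ) (hp : p.Prime) (hn : 2 ≤ n)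
    (giso : (E ≃ₐ[ℚ] E) ≃* Multiplicative (Fin n → ZMod p))
    (K : Fin ((p ^ n - 1) / (p - 1)) → IntermediateField ℚ E)
    (hinj : Function.Injective K)
    (hdeg : ∀ i, finrank ℚ ↥(K i) = p)
    (hall : ∀ L : IntermediateField ℚ E, finrank ℚ ↥L = p → ∃ i, L = K i)
    (hgal : ∀ i, IsGalois ℚ (K i)) (q : ℕ) [Fact q.Prime] (y : ℕ → ℂ) :
    y 1 ^ ((p ^ n - p) / (p - 1)) * y ((span {(q : ℤ)}).inertiaDegIn (𝓞 E)) ^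
      ((span {(q : ℤ)}).primesOver (𝓞 E)).ncard =
    ∏ i, y ((span {(q : ℤ)}).inertiaDegIn (𝓞 (K i))) ^
      ((span {(q : ℤ)}).primesOver (𝓞 (K i))).ncard := by
  have hpf : Fact p.Prime := ⟨hp⟩
  have hq := (Fact.out : q.Prime)
  have hq0 : (span {(q : ℤ)}) ≠ ⊥ := by simpa using hq.ne_zero
  have i7 : (span {(q : ℤ)}).IsMaximal := Int.ideal_span_isMaximal_of_prime q
  have i6 : Finite (ℤ ⧸ span {(q : ℤ)}) := Ring.HasFiniteQuotients.finiteQuotient hq0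
  obtain ⟨⟨P, hP1, hP2⟩⟩ : Nonempty ((span {(q : ℤ)}).primesOver (𝓞 E)) := inferInstance
  have a1 := card_inertia_eq_ramificationIdxIn (G := Gal(E/ℚ)) (span {(q : ℤ)}) P
  have b1 := card_stabilizer_eq (G := Gal(E/ℚ)) (span {(q : ℤ)}) P
  have g1 := ncard_primesOver_mul_ramificationIdxIn_mul_inertiaDegIn (span {(q : ℤ)}) (𝓞 E) Gal(E/ℚ)
  have f1 := inertiaDegIn_eq_inertiaDeg (span {(q : ℤ)}) P Gal(E/ℚ)
  have hG : ∀ σ : Gal(E/ℚ), σ ^ p = 1 := by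
    intro σ
    apply giso.injective
    rw [map_pow, map_one]
    apply Multiplicative.toAdd.injective
    funext i
    simp
  have hcard : Nat.card Gal(E/ℚ) = p ^ n := by
    rw [Nat.card_congr giso.toEquiv]
    simp
  have f2 := inertia_le q p P hG hp.pos
  obtain ⟨t0, t1⟩ := t_facts p n hp hn
  rw [t1]
  have cnt : ∀ D : Subgroup Gal(E/ℚ), (p - 1) * Nat.card {i // D ≤ (K i).fixingSubgroup} + 1 =
      D.index := by
    intro D
    rw [← count_sub p n _ giso D]
    congr 2
    refine Nat.card_congr (Equiv.ofBijective
      (fun i => ⟨(K i.1).fixingSubgroup, by rw [index_fix, hdeg], i.2⟩) ⟨?_, ?_⟩)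
    · intro i j hij
      simp only [Subtype.mk.injEq] at hij
      apply Subtype.ext
      apply hinj
      rw [← IsGalois.fixedField_fixingSubgroup (K i.1), hij, IsGalois.fixedField_fixingSubgroup]
    · rintro ⟨H, hH, hDH⟩
      obtain ⟨i, hi⟩ := hall (IntermediateField.fixedField H) (by
        rw [← index_fix, IntermediateField.fixingSubgroup_fixedField, hH])
      have : (K i).fixingSubgroup = H := by
        rw [← hi, IntermediateField.fixingSubgroup_fixedField]
      exact ⟨⟨i, by rw [this]; exact hDH⟩, Subtype.ext this⟩
  have cI : 0 < Nat.card (P.inertia Gal(E/ℚ)) := Nat.card_pos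
  have cD : 0 < Nat.card (MulAction.stabilizer Gal(E/ℚ) P) := Nat.card_pos
  have hID : P.inertia Gal(E/ℚ) ≤ MulAction.stabilizer Gal(E/ℚ) P := Ideal.inertia_le_stabilizer P
  refine comb_id _ p _ _ hp t0 (fun i => MulAction.stabilizer Gal(E/ℚ) P ≤ (K i).fixingSubgroup)
    (fun i => P.inertia Gal(E/ℚ) ≤ (K i).fixingSubgroup) (fun i h => hID.trans h) _ _
    (fun i => (local_type (K i) q p hp (hdeg i) P).1)
    (fun i => (local_type (K i) q p hp (hdeg i) P).2.1)
    (fun i => (local_type (K i) q p hp (hdeg i) P).2.2) ?_ ?_ ?_ y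
  · rw [cnt]
    have := (MulAction.stabilizer Gal(E/ℚ) P).index_mul_card
    rw [← g1, ← b1] at this
    exact Nat.eq_of_mul_eq_mul_right cD this
  · rw [cnt]
    have := (P.inertia Gal(E/ℚ)).index_mul_card
    rw [← g1, a1] at this
    rw [a1] at cI
    refine Nat.eq_of_mul_eq_mul_right cI (this.trans ?_)
    ring
  · rw [← f1] at f2
    have hd : (span {(q : ℤ)}).inertiaDegIn (𝓞 E) ∣ p ^ n := by
      rw [← hcard, ← g1, ← mul_assoc]
      exact dvd_mul_left _ _
    obtain ⟨k, hk, hk'⟩ := (Nat.dvd_prime_pow hp).1 hd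
    rw [hk'] at f2 ⊢
    have : k ≤ 1 := by
      have : p ^ k ≤ p ^ 1 := by simpa using f2
      exact (Nat.pow_le_pow_iff_right hp.one_lt).1 this
    interval_cases k <;> simp
end E

lemma hasProd_pow_aux {β : Type*} {f : β → ℂ} {a : ℂ} (h : HasProd f a) (k : ℕ) :
    HasProd (fun b => f b ^ k) (a ^ k) := by
  induction k with
  | zero => simpa using (hasProd_one : HasProd (fun _ : β => (1 : ℂ)) 1)
  | succ k ih => simpa only [pow_succ] using ih.mul h

theorem dedekindZeta_prod_of_p_elementary
    (p n : ℕ) (hp : p.Prime) (hn : 2 ≤ n)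
    (E : Type*) [Field E] [NumberField E] (hreal : IsTotallyReal E)
    [IsGalois ℚ E]
    (giso : (E ≃ₐ[ℚ] E) ≃* Multiplicative (Fin n → ZMod p))
    (K : Fin ((p ^ n - 1) / (p - 1)) → IntermediateField ℚ E)
    (hinj : Function.Injective K)
    (hdeg : ∀ i, finrank ℚ ↥(K i) = p)
    (hall : ∀ L : IntermediateField ℚ E, finrank ℚ ↥L = p → ∃ i, L = K i)
    (ZE : ℂ → ℂ) (hZE : IsDedekindZeta E ZE)
    (ZK : Fin ((p ^ n - 1) / (p - 1)) → ℂ → ℂ)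
    (hZK : ∀ i, IsDedekindZeta ↥(K i) (ZK i)) :
    ∀ s : ℂ, s ≠ 1 →
      riemannZeta s ^ ((p ^ n - p) / (p - 1)) * ZE s = ∏ i, ZK i s := by
  have hgal : ∀ i, IsGalois ℚ (K i) := by
    intro i
    have hn : (K i).fixingSubgroup.Normal := by
      constructor
      intro a ha b
      have : b * a * b⁻¹ = a := by
        apply giso.injective
        rw [map_mul, map_mul, map_inv, mul_comm (giso b), mul_inv_cancel_right]
      rwa [this]
    have := IsGalois.of_fixedField_normal_subgroup (K i).fixingSubgroup
    rwa [IsGalois.fixedField_fixingSubgroup] at this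
  have main : ∀ s : ℂ, 1 < s.re →
      riemannZeta s ^ ((p ^ n - p) / (p - 1)) * ZE s = ∏ i, ZK i s := by
    intro s hs
    have h1 := (hasProd_pow_aux (riemannZeta_eulerProduct_hasProd hs)
      ((p ^ n - p) / (p - 1))).mul (zeta_hasProd E s hs)
    rw [← hZE.2 s hs] at h1
    have h2 := hasProd_prod (s := Finset.univ) (fun i _ => zeta_hasProd (K i) s hs)
    have h3 : ∏ i, ZK i s = _ := Finset.prod_congr rfl fun i _ => (hZK i).2 s hs
    rw [← h3] at h2
    refine h1.unique ?_
    convert h2 using 1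
    funext q
    have hq : Fact (q : ℕ).Prime := ⟨q.2⟩
    have h4 := local_main p n hp hn giso K hinj hdeg hall hgal (q : ℕ)
      (fun k => (1 - (((q : ℕ) : ℂ) ^ (-s)) ^ k)⁻¹)
    simp only [pow_one] at h4
    exact h4
  have hopen : IsOpen ({1}ᶜ : Set ℂ) := isOpen_compl_singleton
  have d1 : DifferentiableOn ℂ (fun s => riemannZeta s ^ ((p ^ n - p) / (p - 1)) * ZE s) {1}ᶜ := by
    intro s hs
    exact (((differentiableAt_riemannZeta hs).pow _).mul (hZE.1 s hs)).differentiableWithinAt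
  have d2 : DifferentiableOn ℂ (fun s => ∏ i, ZK i s) {1}ᶜ := by
    intro s hs
    exact (DifferentiableAt.fun_finsetProd fun i _ => (hZK i).1 s hs).differentiableWithinAt
  have hc : IsPreconnected ({1}ᶜ : Set ℂ) :=
    (isConnected_compl_singleton_of_one_lt_rank (by simp) 1).isPreconnected
  have hev : ∀ᶠ s : ℂ in nhds 2, 1 < s.re :=
    (isOpen_lt continuous_const Complex.continuous_re).mem_nhds (by simp)
  intro s hs
  exact (d1.analyticOnNhd hopen).eqOn_of_preconnected_of_eventuallyEq (d2.analyticOnNhd hopen) hc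
    (z₀ := 2) (by simp) (hev.mono main) hs
end
end
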